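/- Let K ⊂ ℝ^n be a convex body of class C²₊ with centroid at the origin. Then for every real number p with p ≠ −n and p ≠ 0, the duality formula as_p(K) = as_{n²/p}(K°) holds. -/

import Mathlib

open MeasureTheory Filter Set
open scoped RealInnerProductSpace Topology NNReal ENNReal

noncomputable section

namespace LpAffine

/-- Euclidean space ℝⁿ. -/
abbrev E (n : ℕ) := EuclideanSpace ℝ (Fin n)

/-- A convex body: a compact convex set with nonempty interior. -/
def IsConvexBody {n : ℕ} (K : Set (E n)) : Prop :=
  Convex ℝ K ∧ IsCompact K ∧ (interior K).Nonempty

/-- The polar body `K° = {y : ⟪x,y⟫ ≤ 1 ∀ x ∈ K}`. -/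
def polarBody {n : ℕ} (K : Set (E n)) : Set (E n) := {y | ∀ x ∈ K, ⟪x, y⟫ ≤ 1}

/-- n-dimensional volume (Lebesgue). -/
def vol {n : ℕ} (K : Set (E n)) : ℝ := (volume K).toReal

/-- (n-1)-dimensional Hausdorff measure on ℝⁿ, used as boundary (surface) measure. -/
def bdMeasure (n : ℕ) : Measure (E n) := μH[(n : ℝ) - 1]

/-- The surface area measure μ_K on ∂K. -/
def surfaceMeasure {n : ℕ} (K : Set (E n)) : Measure (E n) :=
  (bdMeasure n).restrict (frontier K)

/-- The centroid (center of gravity) of K is at the origin. -/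
def CentroidAtOrigin {n : ℕ} (K : Set (E n)) : Prop := (∫ x in K, x) = (0 : E n)

/-- ν is an outer unit normal map for K: at each boundary point x, ν x is a unit vector
and the hyperplane through x with normal ν x supports K. -/
def IsOuterNormal {n : ℕ} (K : Set (E n)) (ν : E n → E n) : Prop :=
  ∀ x ∈ frontier K, ‖ν x‖ = 1 ∧ ∀ z ∈ K, ⟪z, ν x⟫ ≤ ⟪x, ν x⟫

/-- k is the (generalized) Gaussian curvature of K at the boundary point x:
the density of the spherical image measure with respect to the surface measure at x. -/
def IsGaussCurvatureAt {n : ℕ} (K : Set (E n)) (ν : E n → E n) (x : E n) (k : ℝ) : Prop :=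
  Tendsto (fun ε : ℝ =>
      (bdMeasure n (ν '' (frontier K ∩ Metric.ball x ε))).toReal /
        (bdMeasure n (frontier K ∩ Metric.ball x ε)).toReal)
    (𝓝[>] 0) (𝓝 k)

/-- κ is a generalized Gauss curvature function for K (defined μ_K-almost everywhere). -/
def IsGaussCurvature {n : ℕ} (K : Set (E n)) (ν : E n → E n) (κ : E n → ℝ) : Prop :=
  ∀ᵐ x ∂(surfaceMeasure K), IsGaussCurvatureAt K ν x (κ x)

/-- K is of class C²₊ with outer normal map ν and Gaussian curvature κ:
K is a convex body, ν is a continuous outer normal map which maps ∂K bijectively onto the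
unit sphere, and κ is a continuous, everywhere strictly positive Gaussian curvature. -/
def IsC2PlusBody {n : ℕ} (K : Set (E n)) (ν : E n → E n) (κ : E n → ℝ) : Prop :=
  IsConvexBody K ∧ IsOuterNormal K ν ∧
    ContinuousOn ν (frontier K) ∧ ContinuousOn κ (frontier K) ∧
    Set.BijOn ν (frontier K) (Metric.sphere (0 : E n) 1) ∧
    ∀ x ∈ frontier K, IsGaussCurvatureAt K ν x (κ x) ∧ 0 < κ x

/-- The L_p affine surface area
`as_p(K) = ∫_{∂K} κ(x)^{p/(n+p)} / ⟪x, ν x⟫^{n(p-1)/(n+p)} dμ_K(x)`. -/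
def asp {n : ℕ} (p : ℝ) (K : Set (E n)) (ν : E n → E n) (κ : E n → ℝ) : ℝ :=
  ∫ x in frontier K,
    κ x ^ (p / ((n : ℝ) + p)) / ⟪x, ν x⟫ ^ ((n : ℝ) * (p - 1) / ((n : ℝ) + p))
    ∂(bdMeasure n)

/-- The convex floating body K_δ: the intersection of all closed halfspaces whose defining
hyperplanes cut off a set of volume δ from K. -/
def floatingBody {n : ℕ} (K : Set (E n)) (δ : ℝ) : Set (E n) :=
  ⋂ (u : E n) (t : ℝ) (_ : ‖u‖ = 1 ∧ vol (K ∩ {z | t ≤ ⟪z, u⟫}) = δ),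
    {z : E n | ⟪z, u⟫ ≤ t}

/-- The surface body K_{f,s}: the intersection of all closed halfspaces H⁺ whose defining
hyperplanes H cut off a set of f μ_K-measure at most s from ∂K. -/
def surfaceBody {n : ℕ} (K : Set (E n)) (f : E n → ℝ) (s : ℝ) : Set (E n) :=
  ⋂ (u : E n) (t : ℝ)
    (_ : ‖u‖ = 1 ∧ (∫ x in frontier K ∩ {z | t ≤ ⟪z, u⟫}, f x ∂(bdMeasure n)) ≤ s),
    {z : E n | ⟪z, u⟫ ≤ t}

/-- The constant c_n = 2 (|B₂^{n-1}|/(n+1))^{2/(n+1)}. -/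
def cn (n : ℕ) : ℝ :=
  2 * ((volume (Metric.closedBall (0 : EuclideanSpace ℝ (Fin (n - 1))) 1)).toReal /
    ((n : ℝ) + 1)) ^ (2 / ((n : ℝ) + 1))

/-- The constant β_n = 2 |B₂^{n-1}|^{2/(n-1)}. -/
def betan (n : ℕ) : ℝ :=
  2 * ((volume (Metric.closedBall (0 : EuclideanSpace ℝ (Fin (n - 1))) 1)).toReal) ^
    (2 / ((n : ℝ) - 1))

/-- The support function h_K(u) = sup_{x ∈ K} ⟪x, u⟫. -/
def suppFn {n : ℕ} (K : Set (E n)) (u : E n) : ℝ := sSup ((fun x => ⟪x, u⟫) '' K)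

/-- The inverse Gauss map N_K⁻¹ : S^{n-1} → ∂K. -/
def gaussInv {n : ℕ} (K : Set (E n)) (ν : E n → E n) : E n → E n :=
  Function.invFunOn ν (frontier K)

/-- The curvature function f_K(u): the reciprocal of the Gaussian curvature at the boundary
point with outer normal u. -/
def curvFn {n : ℕ} (K : Set (E n)) (ν : E n → E n) (κ : E n → ℝ) (u : E n) : ℝ :=
  1 / κ (gaussInv K ν u)

/-- The L_{-n} affine surface area
`as_{-n}(K) = max_{u ∈ S^{n-1}} f_K(u)^{1/2} h_K(u)^{(n+1)/2}`. -/
def asNegN {n : ℕ} (K : Set (E n)) (ν : E n → E n) (κ : E n → ℝ) : ℝ :=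
  sSup ((fun u => curvFn K ν κ u ^ ((1 : ℝ) / 2) * suppFn K u ^ (((n : ℝ) + 1) / 2)) ''
    Metric.sphere (0 : E n) 1)

/-- K is an ellipsoid: the image of the Euclidean unit ball under an invertible affine map. -/
def IsEllipsoid {n : ℕ} (K : Set (E n)) : Prop :=
  ∃ (L : E n ≃ₗ[ℝ] E n) (c : E n), K = (fun x => L x + c) '' Metric.closedBall (0 : E n) 1

theorem hausdorffMeasure_image_le_of_dist_le {α β γ : Type*} [MetricSpace α] [MetricSpace β]
    [MetricSpace γ] [MeasurableSpace β] [BorelSpace β] [MeasurableSpace γ] [BorelSpace γ]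
    {f : α → β} {g : α → γ} {A : Set α} {C : ℝ≥0} {d : ℝ} (hd : 0 ≤ d)
    (h : ∀ x ∈ A, ∀ y ∈ A, dist (f x) (f y) ≤ C * dist (g x) (g y)) :
    μH[d] (f '' A) ≤ (C : ℝ≥0∞) ^ d * μH[d] (g '' A) := by
  rcases A.eq_empty_or_nonempty with rfl | ⟨a, -⟩
  · simp
  have : Nonempty α := ⟨a⟩
  set i : γ → α := Function.invFunOn g A
  have hi : ∀ x ∈ A, i (g x) ∈ A ∧ g (i (g x)) = g x := fun x hx =>
    ⟨Function.invFunOn_mem ⟨x, hx, rfl⟩, Function.invFunOn_eq ⟨x, hx, rfl⟩⟩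
  have hlip : LipschitzOnWith C (f ∘ i) (g '' A) := by
    refine LipschitzOnWith.of_dist_le_mul ?_
    rintro _ ⟨x, hx, rfl⟩ _ ⟨y, hy, rfl⟩
    have := h _ (hi x hx).1 _ (hi y hy).1
    rwa [(hi x hx).2, (hi y hy).2] at this
  refine le_trans (measure_mono ?_) (hlip.hausdorffMeasure_image_le hd)
  rintro _ ⟨x, hx, rfl⟩
  refine ⟨g x, ⟨x, hx, rfl⟩, ?_⟩
  have := h _ (hi x hx).1 _ hx
  rw [(hi x hx).2, dist_self, mul_zero] at this
  exact dist_le_zero.1 this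

section Linearization

variable {U W : Type*} [NormedAddCommGroup U] [InnerProductSpace ℝ U] [FiniteDimensional ℝ U]
  [MeasurableSpace U] [BorelSpace U]
  [NormedAddCommGroup W] [InnerProductSpace ℝ W] [MeasurableSpace W] [BorelSpace W]

/-- If, on a set `A` close to the subspace `V`, a map `f` is bi-Lipschitz close to `S ∘ P`, then
`f` scales the Hausdorff measure of `A` approximately by the normalized determinant of `S`. -/
theorem hausdorffMeasure_image_of_dist_le (V : Submodule ℝ U) (S : V →ₗ[ℝ] W) (f : U → W)
    (P : U → V) {A : Set U} {C : ℝ≥0}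
    (hP : ∀ x ∈ A, ∀ y ∈ A, dist (P x) (P y) ≤ dist x y)
    (hP' : ∀ x ∈ A, ∀ y ∈ A, dist x y ≤ C * dist (P x) (P y))
    (hf : ∀ x ∈ A, ∀ y ∈ A, dist (f x) (f y) ≤ C * dist (S (P x)) (S (P y)))
    (hf' : ∀ x ∈ A, ∀ y ∈ A, dist (S (P x)) (S (P y)) ≤ C * dist (f x) (f y)) :
    μH[Module.finrank ℝ V] (f '' A) ≤ (C : ℝ≥0∞) ^ (Module.finrank ℝ V : ℝ) *
        (ENNReal.ofReal S.normDet * μH[Module.finrank ℝ V] A) ∧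
      ENNReal.ofReal S.normDet * μH[Module.finrank ℝ V] A ≤
        (C : ℝ≥0∞) ^ (Module.finrank ℝ V : ℝ) * ((C : ℝ≥0∞) ^ (Module.finrank ℝ V : ℝ) *
          μH[Module.finrank ℝ V] (f '' A)) := by
  have hd : (0 : ℝ) ≤ Module.finrank ℝ V := Nat.cast_nonneg _
  have hS := S.hausdorffMeasure_image (P '' A)
  rw [Set.image_image] at hS
  have h1 := hausdorffMeasure_image_le_of_dist_le (f := P) (g := id) (C := 1) hd
    (by simpa using hP)
  have h2 := hausdorffMeasure_image_le_of_dist_le (f := id) (g := P) hd hP'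
  have h3 := hausdorffMeasure_image_le_of_dist_le (f := f) (g := fun x => S (P x)) hd hf
  have h4 := hausdorffMeasure_image_le_of_dist_le (f := fun x => S (P x)) (g := f) hd hf'
  simp only [Set.image_id, ENNReal.coe_one, ENNReal.one_rpow, one_mul] at h1 h2
  rw [hS] at h3 h4
  constructor
  · refine h3.trans ?_
    gcongr
  · calc _ ≤ ENNReal.ofReal S.normDet * ((C : ℝ≥0∞) ^ (Module.finrank ℝ V : ℝ) *
          μH[Module.finrank ℝ V] (P '' A)) := by gcongr
      _ = (C : ℝ≥0∞) ^ (Module.finrank ℝ V : ℝ) * (ENNReal.ofReal S.normDet *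
          μH[Module.finrank ℝ V] (P '' A)) := by ring
      _ ≤ _ := by gcongr

theorem exists_nhds_hausdorffMeasure_image (V : Submodule ℝ U) {S : V →ₗ[ℝ] W}
    (hS : Function.Injective S) {f : U → W} {X : Set U} {x₀ : U}
    (h : ∀ η > (0 : ℝ), ∃ t ∈ 𝓝 x₀, ∀ x ∈ X ∩ t, ∀ y ∈ X ∩ t,
      ‖x - y - V.orthogonalProjectionOnto (x - y)‖ ≤ η * ‖x - y‖ ∧
      ‖f x - f y - S (V.orthogonalProjectionOnto (x - y))‖ ≤ η * ‖x - y‖)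
    {c : ℝ} (hc : 1 < c) :
    ∃ t ∈ 𝓝 x₀, ∀ A ⊆ X ∩ t,
      μH[Module.finrank ℝ V] (f '' A) ≤
        ENNReal.ofReal (c * S.normDet) * μH[Module.finrank ℝ V] A ∧
      ENNReal.ofReal S.normDet * μH[Module.finrank ℝ V] A ≤
        ENNReal.ofReal c * μH[Module.finrank ℝ V] (f '' A) := by
  set d := Module.finrank ℝ V
  obtain ⟨C, hC, hC1⟩ : ∃ C : ℝ, C ^ (d : ℝ) * C ^ (d : ℝ) < c ∧ 1 < C := by
    have hcont : Tendsto (fun C : ℝ => C ^ (d : ℝ) * C ^ (d : ℝ)) (𝓝[>] 1) (𝓝 1) := by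
      have : ContinuousAt (fun C : ℝ => C ^ (d : ℝ) * C ^ (d : ℝ)) 1 :=
        (Real.continuousAt_rpow_const _ _ (by simp)).mul
          (Real.continuousAt_rpow_const _ _ (by simp))
      simpa [ContinuousAt] using this.tendsto.mono_left nhdsWithin_le_nhds
    exact ((hcont.eventually_lt_const hc).and self_mem_nhdsWithin).exists
  have hC0 : 0 < C := by linarith
  lift C to ℝ≥0 using hC0.le
  obtain ⟨L, hL, hLS⟩ := S.exists_antilipschitzWith (LinearMap.ker_eq_bot.2 hS)
  have hL' : (0 : ℝ) < L := hL
  have hLw : ∀ w : V, ‖w‖ ≤ L * ‖S w‖ := fun w => by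
    simpa using hLS.le_mul_dist w 0
  have hη : 0 < ((C : ℝ) - 1) / (C * (1 + C * L)) := by
    have : 0 < (C : ℝ) - 1 := by linarith
    positivity
  obtain ⟨t, ht, hxy⟩ := h _ hη
  set η := ((C : ℝ) - 1) / (C * (1 + C * L)) with hηdef
  have hηC : η * (1 + C * L) * C = C - 1 := by
    rw [hηdef]; field_simp
  have hηCL : 0 < η * (C * L) := by positivity
  set P : U → V := fun x => V.orthogonalProjectionOnto x with hPdef
  have hPsub : ∀ x y, P (x - y) = P x - P y := fun x y => map_sub _ _ _
  have key : ∀ x ∈ X ∩ t, ∀ y ∈ X ∩ t, dist x y ≤ C * dist (P x) (P y) ∧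
      dist (f x) (f y) ≤ C * dist (S (P x)) (S (P y)) ∧
      dist (S (P x)) (S (P y)) ≤ C * dist (f x) (f y) := by
    intro x hx y hy
    obtain ⟨e1, e2⟩ := hxy x hx y hy
    have hb := hLw (P (x - y))
    rw [dist_eq_norm, dist_eq_norm, dist_eq_norm, dist_eq_norm, ← map_sub S, ← hPsub]
    change ‖x - y - (P (x - y) : U)‖ ≤ _ at e1
    change ‖f x - f y - S (P (x - y))‖ ≤ _ at e2
    have t1 : ‖x - y‖ ≤ ‖P (x - y)‖ + η * ‖x - y‖ := by
      have := norm_le_norm_add_norm_sub' (x - y) (P (x - y) : U)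
      rw [Submodule.coe_norm] at *
      linarith
    have t2 : ‖f x - f y‖ ≤ ‖S (P (x - y))‖ + η * ‖x - y‖ := by
      have := norm_le_norm_add_norm_sub' (f x - f y) (S (P (x - y)))
      linarith
    have t3 : ‖S (P (x - y))‖ ≤ ‖f x - f y‖ + η * ‖x - y‖ := by
      have := norm_le_norm_add_norm_sub (f x - f y) (S (P (x - y)))
      linarith
    have hs := norm_nonneg (S (P (x - y)))
    have hD := norm_nonneg (x - y)
    generalize ‖x - y‖ = D at *
    generalize ‖P (x - y)‖ = B at *
    generalize ‖S (P (x - y))‖ = s at *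
    generalize ‖f x - f y‖ = F at *
    have hDB : D ≤ C * B := by
      nlinarith [mul_nonneg (mul_nonneg hη.le hC0.le) (mul_nonneg (mul_nonneg hC0.le hL'.le) hD)]
    have hDs : η * D ≤ η * (C * L) * s := by
      have : D ≤ C * (L * s) := hDB.trans (by gcongr)
      nlinarith
    have h1 : η * (C * L) * C ≤ C - 1 := by nlinarith
    have h2 : η * (C * L) * s * C ≤ (C - 1) * s := by nlinarith
    have h3 : η * (C * L) * s ≤ η * (C * L) * s * C := by
      nlinarith [mul_nonneg hηCL.le hs]
    exact ⟨hDB, by linarith, by nlinarith⟩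
  refine ⟨t, ht, fun A hA => ?_⟩
  have main := hausdorffMeasure_image_of_dist_le V S f P (A := A) (C := C)
    (fun x _ y _ => by simpa using V.lipschitzWith_orthogonalProjectionOnto.dist_le_mul x y)
    (fun x hx y hy => (key x (hA hx) y (hA hy)).1)
    (fun x hx y hy => (key x (hA hx) y (hA hy)).2.1)
    (fun x hx y hy => (key x (hA hx) y (hA hy)).2.2)
  have hCC : (C : ℝ≥0∞) ^ (d : ℝ) = ENNReal.ofReal ((C : ℝ) ^ (d : ℝ)) := by
    rw [← ENNReal.ofReal_rpow_of_pos hC0, ENNReal.ofReal_coe_nnreal]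
  have hCd : 1 ≤ (C : ℝ) ^ (d : ℝ) := Real.one_le_rpow hC1.le (Nat.cast_nonneg _)
  have hCc : (C : ℝ) ^ (d : ℝ) ≤ c := by nlinarith
  change _ ≤ (C : ℝ≥0∞) ^ (d : ℝ) * _ ∧
    _ ≤ (C : ℝ≥0∞) ^ (d : ℝ) *
      ((C : ℝ≥0∞) ^ (d : ℝ) * _) at main
  rw [hCC, ← mul_assoc, ← mul_assoc, ← ENNReal.ofReal_mul (by positivity),
    ← ENNReal.ofReal_mul (by positivity)] at main
  have := S.normDet_nonneg
  refine ⟨main.1.trans ?_, main.2.trans ?_⟩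
  · gcongr
  · gcongr

end Linearization

section Radial

variable {U : Type*} [NormedAddCommGroup U] [InnerProductSpace ℝ U]

/-- The radial projection onto the unit sphere. -/
def radialProj (x : U) : U := ‖x‖⁻¹ • x

/-- The derivative of the radial projection. -/
def radialDeriv (x : U) : U →L[ℝ] U :=
  ‖x‖⁻¹ • (ContinuousLinearMap.id ℝ U -
    (innerSL ℝ (radialProj x)).smulRight (radialProj x))

theorem radialDeriv_apply (x z : U) :
    radialDeriv x z = ‖x‖⁻¹ • (z - ⟪radialProj x, z⟫ • radialProj x) := rfl

theorem norm_radialProj {x : U} (hx : x ≠ 0) : ‖radialProj x‖ = 1 := by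
  rw [radialProj, norm_smul, norm_inv, norm_norm, inv_mul_cancel₀ (norm_ne_zero_iff.2 hx)]

theorem hasStrictFDerivAt_radialProj {x : U} (hx : x ≠ 0) :
    HasStrictFDerivAt radialProj (radialDeriv x) x := by
  have hn : ‖x‖ ≠ 0 := norm_ne_zero_iff.2 hx
  have h1 := (((hasStrictDerivAt_inv (by positivity)).comp (‖x‖ ^ 2)
    (Real.hasStrictDerivAt_sqrt (by positivity))).comp_hasStrictFDerivAt x
      (hasStrictFDerivAt_norm_sq x)).smul (hasStrictFDerivAt_id x)
  refine (h1.congr_fderiv (g' := radialDeriv x) ?_).congr_of_eventuallyEq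
    (.of_forall fun y => by simp [radialProj])
  ext1 z
  simp only [radialDeriv_apply, radialProj, Real.sqrt_sq (norm_nonneg x), smul_add, smul_smul,
    real_inner_smul_left, add_apply, smul_apply,
    ContinuousLinearMap.smulRight_apply, innerSL_apply_apply, Function.comp,
    ContinuousLinearMap.id_apply, id, smul_eq_mul, nsmul_eq_mul, sub_eq_add_neg, ← neg_smul]
  congr 2
  field_simp
  push_cast
  ring

theorem coe_orthogonalProjectionOnto_orthogonal_singleton {v : U} (hv : ‖v‖ = 1) (z : U) :
    ((ℝ ∙ v)ᗮ.orthogonalProjectionOnto z : U) = z - ⟪v, z⟫ • v := by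
  rw [← Submodule.starProjection_unit_singleton ℝ hv z, Submodule.coe_orthogonalProjectionOnto_apply,
    Submodule.starProjection_orthogonal_val]

theorem normDet_radialDeriv [FiniteDimensional ℝ U] {x v : U} (hx : x ≠ 0) (hv : ‖v‖ = 1)
    (hxv : 0 < ⟪x, v⟫) :
    ((radialDeriv x).toLinearMap ∘ₗ (ℝ ∙ v)ᗮ.subtype).normDet =
      ⟪x, v⟫ / ‖x‖ ^ Module.finrank ℝ U := by
  have hv0 : v ≠ 0 := by rintro rfl; simp at hv
  have hr : 0 < ‖x‖ := norm_pos_iff.2 hx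
  set u := radialProj x with hu
  have hu1 : ‖u‖ = 1 := norm_radialProj hx
  set V := (ℝ ∙ v)ᗮ with hV
  set q : V := V.orthogonalProjectionOnto u with hq
  have hfin : Module.finrank ℝ V + 1 = Module.finrank ℝ U := by
    have := (ℝ ∙ v).finrank_add_finrank_orthogonal
    rw [finrank_span_singleton hv0] at this
    rw [← this, add_comm]
  have hqz : ∀ z : V, ⟪u, (z : U)⟫ = ⟪q, z⟫ := fun z => by
    rw [hq, Submodule.inner_orthogonalProjectionOnto_eq_of_mem_right]
  have hqq : ⟪q, q⟫ = 1 - ⟪u, v⟫ ^ 2 := by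
    rw [← hqz, hq, coe_orthogonalProjectionOnto_orthogonal_singleton hv, inner_sub_right,
      real_inner_self_eq_norm_sq, hu1, real_inner_smul_right, real_inner_comm v u]
    ring
  set S := (radialDeriv x).toLinearMap ∘ₗ V.subtype with hS
  have hSS : S.adjoint ∘ₗ S =
      (‖x‖⁻¹ ^ 2) • LinearMap.transvection (-(innerₗ V q)) q := by
    ext1 w
    refine ext_inner_left ℝ fun z => ?_
    rw [LinearMap.comp_apply, LinearMap.adjoint_inner_right]
    have hSz : ∀ z : V, S z = ‖x‖⁻¹ • ((z : U) - ⟪u, (z : U)⟫ • u) := fun z => rfl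
    rw [hSz, hSz, hqz, hqz, LinearMap.smul_apply, LinearMap.transvection.apply]
    simp only [real_inner_smul_left, real_inner_smul_right, inner_sub_left, inner_sub_right,
      inner_add_right, smul_add, LinearMap.neg_apply, innerₗ_apply_apply, real_inner_self_eq_norm_sq, hu1,
      real_inner_comm u, hqz, ← real_inner_comm q z, Submodule.coe_inner, Submodule.coe_smul]
    ring
  have hdet : S.normDet ^ 2 = (⟪x, v⟫ / ‖x‖ ^ Module.finrank ℝ U) ^ 2 := by
    have := S.normDet_sq
    rw [hSS, LinearMap.det_smul, LinearMap.transvection.det, LinearMap.neg_apply,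
      innerₗ_apply_apply, hqq] at this
    rw [show S.normDet ^ 2 = _ from this, ← hfin, hu, radialProj, real_inner_smul_left,
      pow_succ _ (Module.finrank ℝ V), ← pow_mul, inv_pow, mul_comm 2, pow_mul]
    field_simp
    ring
  have h2 : 0 ≤ ⟪x, v⟫ / ‖x‖ ^ Module.finrank ℝ U := by positivity
  exact (sq_eq_sq₀ S.normDet_nonneg h2).1 hdet

end Radial

theorem exists_nhds_norm_radialProj_sub_le {U : Type*} [NormedAddCommGroup U]
    [InnerProductSpace ℝ U] {X : Set U} {ν : U → U}
    (hsupp : ∀ x ∈ X, ∀ y ∈ X, ⟪y, ν x⟫ ≤ ⟪x, ν x⟫) {x₀ : U} (hx0 : x₀ ≠ 0)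
    (hcont : ContinuousWithinAt ν X x₀) {η : ℝ} (hη : 0 < η) :
    ∃ t ∈ 𝓝 x₀, ∀ x ∈ X ∩ t, ∀ y ∈ X ∩ t, |⟪ν x₀, x - y⟫| ≤ η * ‖x - y‖ ∧
      ‖radialProj x - radialProj y - radialDeriv x₀ (x - y - ⟪ν x₀, x - y⟫ • ν x₀)‖ ≤
        η * ‖x - y‖ := by
  set M := ‖radialDeriv x₀‖ * ‖ν x₀‖ with hM
  have hM0 : 0 ≤ M := by positivity
  have hδ : 0 < η / (2 * (1 + M)) := by positivity
  set δ := η / (2 * (1 + M)) with hδdef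
  have hδM : δ * (1 + M) = η / 2 := by rw [hδdef]; field_simp
  have hδη : δ ≤ η / 2 := by nlinarith
  obtain ⟨t₁, ht₁, h₁⟩ : ∃ t ∈ 𝓝 x₀, ∀ x ∈ X ∩ t, ‖ν x - ν x₀‖ ≤ δ := by
    have := hcont.eventually (Metric.closedBall_mem_nhds (ν x₀) hδ)
    rw [eventually_nhdsWithin_iff] at this
    exact ⟨_, this, fun x hx => by simpa [dist_eq_norm] using hx.2 hx.1⟩
  obtain ⟨t₂, ht₂, h₂⟩ : ∃ t ∈ 𝓝 x₀, ∀ x ∈ t, ∀ y ∈ t,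
      ‖radialProj x - radialProj y - radialDeriv x₀ (x - y)‖ ≤ η / 2 * ‖x - y‖ := by
    have := (hasStrictFDerivAt_radialProj hx0).isLittleO.def (half_pos hη)
    rw [nhds_prod_eq] at this
    obtain ⟨t, ht, hh⟩ := Filter.mem_prod_self_iff.1 this
    exact ⟨_, ht, fun x hx y hy => hh (Set.mk_mem_prod hx hy)⟩
  refine ⟨t₁ ∩ t₂, Filter.inter_mem ht₁ ht₂, fun x hx y hy => ?_⟩
  have hin : |⟪ν x₀, x - y⟫| ≤ δ * ‖x - y‖ := by
    have hxx := hsupp x hx.1 y hy.1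
    have hyy := hsupp y hy.1 x hx.1
    have b : ∀ z ∈ X ∩ t₁, |⟪ν z - ν x₀, x - y⟫| ≤ δ * ‖x - y‖ := fun z hz =>
      (abs_real_inner_le_norm _ _).trans (by gcongr; exact h₁ z hz)
    have bx := abs_le.1 (b x ⟨hx.1, hx.2.1⟩)
    have bz := abs_le.1 (b y ⟨hy.1, hy.2.1⟩)
    rw [real_inner_comm, real_inner_comm (ν x)] at hxx
    rw [real_inner_comm, real_inner_comm (ν y)] at hyy
    simp only [inner_sub_left, inner_sub_right] at bx bz ⊢
    rw [abs_le]
    constructor <;> linarith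
  refine ⟨hin.trans (by gcongr; linarith), ?_⟩
  have e : radialProj x - radialProj y - radialDeriv x₀ (x - y - ⟪ν x₀, x - y⟫ • ν x₀) =
      (radialProj x - radialProj y - radialDeriv x₀ (x - y)) +
        radialDeriv x₀ (⟪ν x₀, x - y⟫ • ν x₀) := by
    rw [map_sub (radialDeriv x₀) (x - y)]
    abel
  rw [e]
  have h3 : ‖radialDeriv x₀ (⟪ν x₀, x - y⟫ • ν x₀)‖ ≤ M * (δ * ‖x - y‖) := by
    refine ((radialDeriv x₀).le_opNorm _).trans ?_
    rw [norm_smul, Real.norm_eq_abs, hM, mul_assoc, mul_comm ‖ν x₀‖]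
    gcongr
  calc _ ≤ η / 2 * ‖x - y‖ + M * (δ * ‖x - y‖) :=
        (norm_add_le _ _).trans (add_le_add (h₂ x hx.2.2 y hy.2.2) h3)
    _ ≤ η * ‖x - y‖ := by nlinarith [norm_nonneg (x - y)]

theorem exists_nhds_bdMeasure_radialProj {n : ℕ} {X : Set (E n)} {ν : E n → E n}
    (hsupp : ∀ x ∈ X, ∀ y ∈ X, ⟪y, ν x⟫ ≤ ⟪x, ν x⟫) {x₀ : E n}
    (hcont : ContinuousWithinAt ν X x₀) (hν : ‖ν x₀‖ = 1) (hpos : 0 < ⟪x₀, ν x₀⟫)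
    {c : ℝ} (hc : 1 < c) :
    ∃ t ∈ 𝓝 x₀, ∀ A ⊆ X ∩ t,
      bdMeasure n (radialProj '' A) ≤
        ENNReal.ofReal (c * (⟪x₀, ν x₀⟫ / ‖x₀‖ ^ n)) * bdMeasure n A ∧
      ENNReal.ofReal (⟪x₀, ν x₀⟫ / ‖x₀‖ ^ n) * bdMeasure n A ≤
        ENNReal.ofReal c * bdMeasure n (radialProj '' A) := by
  have hx0 : x₀ ≠ 0 := by rintro rfl; simp at hpos
  have hv0 : ν x₀ ≠ 0 := by intro h; simp [h] at hν
  have hdet := normDet_radialDeriv hx0 hν hpos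
  rw [finrank_euclideanSpace_fin] at hdet
  have hfin : (Module.finrank ℝ (ℝ ∙ ν x₀)ᗮ : ℝ) = n - 1 := by
    have := (ℝ ∙ ν x₀).finrank_add_finrank_orthogonal
    rw [finrank_span_singleton hv0, finrank_euclideanSpace_fin] at this
    have h2 := congrArg (Nat.cast (R := ℝ)) this
    push_cast at h2
    linarith
  have hinj : Function.Injective ((radialDeriv x₀).toLinearMap ∘ₗ (ℝ ∙ ν x₀)ᗮ.subtype) := by
    have : 0 < ‖x₀‖ := norm_pos_iff.2 hx0
    refine ((LinearMap.normDet_ne_zero_tfae _).out 0 4).1 ?_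
    rw [hdet]
    positivity
  have main := exists_nhds_hausdorffMeasure_image _ hinj (f := radialProj) (X := X) (x₀ := x₀)
    (fun η hη => ?_) hc
  · rw [hfin, hdet] at main
    exact main
  obtain ⟨t, ht, h⟩ := exists_nhds_norm_radialProj_sub_le hsupp hx0 hcont hη
  refine ⟨t, ht, fun x hx y hy => ?_⟩
  have hproj := coe_orthogonalProjectionOnto_orthogonal_singleton hν (x - y)
  obtain ⟨h1, h2⟩ := h x hx y hy
  rw [← hproj] at h2
  refine ⟨?_, h2⟩
  rw [hproj, sub_sub_cancel, norm_smul, hν, mul_one]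
  exact h1

section AsympScale

/-- `f` is asymptotic to `a * g` along `l`, in a form that does not require division. -/
def AsympScale {ι : Type*} (l : Filter ι) (a : ℝ) (f g : ι → ℝ≥0∞) : Prop :=
  ∀ c > (1 : ℝ), ∀ᶠ i in l, f i ≤ ENNReal.ofReal (c * a) * g i ∧
    ENNReal.ofReal a * g i ≤ ENNReal.ofReal c * f i

namespace AsympScale

variable {ι : Type*} {l : Filter ι} {a b : ℝ} {f g k : ι → ℝ≥0∞}

theorem trans (hf : AsympScale l a f g) (hg : AsympScale l b g k) (ha : 0 ≤ a) :
    AsympScale l (a * b) f k := by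
  intro c hc
  have hs : 1 < √c := by rwa [Real.lt_sqrt zero_le_one, one_pow]
  have hs0 : 0 ≤ √c := Real.sqrt_nonneg c
  have hcs : c = √c * √c := (Real.mul_self_sqrt (by linarith)).symm
  filter_upwards [hf _ hs, hg _ hs] with i h1 h2
  constructor
  · calc f i ≤ ENNReal.ofReal (√c * a) * (ENNReal.ofReal (√c * b) * k i) :=
          h1.1.trans (by gcongr; exact h2.1)
      _ = ENNReal.ofReal (c * (a * b)) * k i := by
          rw [← mul_assoc, ← ENNReal.ofReal_mul (by positivity)]
          congr 2
          nth_rewrite 3 [hcs]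
          ring
  · calc ENNReal.ofReal (a * b) * k i = ENNReal.ofReal a * (ENNReal.ofReal b * k i) := by
          rw [ENNReal.ofReal_mul ha, mul_assoc]
      _ ≤ ENNReal.ofReal a * (ENNReal.ofReal (√c) * g i) := mul_le_mul' le_rfl h2.2
      _ = ENNReal.ofReal (√c) * (ENNReal.ofReal a * g i) := by ring
      _ ≤ ENNReal.ofReal (√c) * (ENNReal.ofReal (√c) * f i) := mul_le_mul' le_rfl h1.2
      _ = ENNReal.ofReal c * f i := by
          rw [← mul_assoc, ← ENNReal.ofReal_mul hs0, ← hcs]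

theorem symm (hf : AsympScale l a f g) (ha : 0 < a) : AsympScale l a⁻¹ g f := by
  intro c hc
  filter_upwards [hf c hc] with i h
  have hinv : ENNReal.ofReal a⁻¹ * ENNReal.ofReal a = 1 := by
    rw [← ENNReal.ofReal_mul (by positivity), inv_mul_cancel₀ ha.ne', ENNReal.ofReal_one]
  constructor
  · calc g i = ENNReal.ofReal a⁻¹ * (ENNReal.ofReal a * g i) := by rw [← mul_assoc, hinv, one_mul]
      _ ≤ ENNReal.ofReal a⁻¹ * (ENNReal.ofReal c * f i) := mul_le_mul' le_rfl h.2
      _ = _ := by rw [ENNReal.ofReal_mul (by linarith)]; ring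
  · calc ENNReal.ofReal a⁻¹ * f i ≤ ENNReal.ofReal a⁻¹ * (ENNReal.ofReal (c * a) * g i) := by
          gcongr; exact h.1
      _ = ENNReal.ofReal a⁻¹ * ENNReal.ofReal a * (ENNReal.ofReal c * g i) := by
          rw [ENNReal.ofReal_mul (by linarith)]; ring
      _ = _ := by rw [hinv, one_mul]

theorem of_tendsto_ratio (ha : 0 < a)
    (h : Tendsto (fun i => (f i).toReal / (g i).toReal) l (𝓝 a)) : AsympScale l a f g := by
  intro c hc
  have hc0 : 0 < c := by linarith
  have h1 : a < c * a := by nlinarith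
  have h2 : a / c < a := by rw [div_lt_iff₀ hc0]; nlinarith
  filter_upwards [h.eventually_lt_const h1, h.eventually_const_lt h2,
    h.eventually_const_lt ha] with i u1 u2 u0
  have hg : 0 < (g i).toReal := by
    refine ENNReal.toReal_nonneg.lt_of_ne fun h0 => ?_
    simp [← h0] at u0
  have hf : 0 < (f i).toReal := by
    refine ENNReal.toReal_nonneg.lt_of_ne fun h0 => ?_
    simp [← h0] at u0
  rw [div_lt_iff₀ hg] at u1
  rw [lt_div_iff₀ hg, div_mul_eq_mul_div, div_lt_iff₀ hc0] at u2
  rw [← ENNReal.ofReal_toReal (ENNReal.toReal_pos_iff.1 hf).2.ne,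
    ← ENNReal.ofReal_toReal (ENNReal.toReal_pos_iff.1 hg).2.ne,
    ← ENNReal.ofReal_mul (by positivity), ← ENNReal.ofReal_mul ha.le,
    ← ENNReal.ofReal_mul hc0.le]
  exact ⟨ENNReal.ofReal_le_ofReal u1.le, ENNReal.ofReal_le_ofReal (by linarith)⟩

theorem tendsto_ratio (h : AsympScale l a f g) (ha : 0 ≤ a) (hg : ∀ᶠ i in l, 0 < g i ∧ g i < ∞) :
    Tendsto (fun i => (f i).toReal / (g i).toReal) l (𝓝 a) := by
  have key : ∀ c > (1 : ℝ), ∀ᶠ i in l, a / c ≤ (f i).toReal / (g i).toReal ∧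
      (f i).toReal / (g i).toReal ≤ c * a := by
    intro c hc
    have hc0 : 0 < c := by linarith
    filter_upwards [h c hc, hg] with i hi hgi
    have hg0 : 0 < (g i).toReal := ENNReal.toReal_pos_iff.2 hgi
    have hf : f i ≠ ∞ :=
      (hi.1.trans_lt (ENNReal.mul_lt_top ENNReal.ofReal_lt_top hgi.2)).ne
    obtain ⟨h1, h2⟩ := hi
    rw [← ENNReal.ofReal_toReal hf, ← ENNReal.ofReal_toReal hgi.2.ne,
      ← ENNReal.ofReal_mul (by positivity)] at h1
    rw [← ENNReal.ofReal_toReal hf, ← ENNReal.ofReal_toReal hgi.2.ne,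
      ← ENNReal.ofReal_mul ha, ← ENNReal.ofReal_mul hc0.le] at h2
    rw [ENNReal.ofReal_le_ofReal_iff (by positivity)] at h1 h2
    constructor
    · rw [div_le_div_iff₀ hc0 hg0]; linarith
    · rwa [div_le_iff₀ hg0]
  rw [tendsto_order]
  have h1 : Tendsto (fun c : ℝ => a / c) (𝓝[>] 1) (𝓝 a) := by
    have : ContinuousAt (fun c : ℝ => a / c) 1 := by fun_prop (disch := norm_num)
    simpa [ContinuousAt] using this.tendsto.mono_left nhdsWithin_le_nhds
  have h2 : Tendsto (fun c : ℝ => c * a) (𝓝[>] 1) (𝓝 a) := by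
    have : ContinuousAt (fun c : ℝ => c * a) 1 := by fun_prop
    simpa [ContinuousAt] using this.tendsto.mono_left nhdsWithin_le_nhds
  constructor
  · intro b hb
    obtain ⟨c, hbc, hc⟩ := ((h1.eventually_const_lt hb).and self_mem_nhdsWithin).exists
    filter_upwards [key c hc] with i hi using hbc.trans_le hi.1
  · intro b hb
    obtain ⟨c, hbc, hc⟩ := ((h2.eventually_lt_const hb).and self_mem_nhdsWithin).exists
    filter_upwards [key c hc] with i hi using hi.2.trans_lt hbc

end AsympScale

end AsympScale

section Differentiation

variable {α : Type*} [MetricSpace α] [MeasurableSpace α] [BorelSpace α]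

theorem measure_closedBall_le_of_ball_le {μ ρ : Measure α} [IsFiniteMeasure μ] {x : α}
    {b : ℝ≥0∞} (hb : b ≠ ∞) {δ : ℝ}
    (h : ∀ r ∈ Set.Ioo 0 δ, ρ (Metric.ball x r) ≤ b * μ (Metric.ball x r)) {r : ℝ}
    (hr : r ∈ Set.Ioo 0 δ) :
    ρ (Metric.closedBall x r) ≤ b * μ (Metric.closedBall x r) := by
  have ht := tendsto_measure_biInter_gt (μ := μ) (s := fun s => Metric.closedBall x s) (a := r)
    (fun s _ => Metric.isClosed_closedBall.measurableSet.nullMeasurableSet)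
    (fun i j _ hij => Metric.closedBall_subset_closedBall hij)
    ⟨r + 1, by simp, measure_ne_top _ _⟩
  have hI : ⋂ s, ⋂ (_ : s > r), Metric.closedBall x s = Metric.closedBall x r := by
    ext y
    simp only [Set.mem_iInter, Metric.mem_closedBall]
    exact ⟨fun hy => le_of_forall_gt_imp_ge_of_dense hy, fun hy s hs => hy.trans (le_of_lt hs)⟩
  rw [hI] at ht
  refine ge_of_tendsto (ENNReal.Tendsto.const_mul ht (Or.inr hb)) ?_
  filter_upwards [Ioo_mem_nhdsGT hr.2] with s hs
  calc ρ (Metric.closedBall x r) ≤ ρ (Metric.ball x s) :=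
        measure_mono (Metric.closedBall_subset_ball hs.1)
    _ ≤ b * μ (Metric.ball x s) := h s ⟨hr.1.trans hs.1, hs.2⟩
    _ ≤ b * μ (Metric.closedBall x s) := by gcongr; exact Metric.ball_subset_closedBall

theorem AsympScale.closedBall {μ ρ : Measure α} [IsFiniteMeasure μ] [IsFiniteMeasure ρ] {x : α}
    {a : ℝ} (h : AsympScale (𝓝[>] (0 : ℝ)) a (fun r => ρ (Metric.ball x r))
      (fun r => μ (Metric.ball x r))) :
    AsympScale (𝓝[>] (0 : ℝ)) a (fun r => ρ (Metric.closedBall x r))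
      (fun r => μ (Metric.closedBall x r)) := by
  have key : ∀ {μ ρ : Measure α} [IsFiniteMeasure μ] {b : ℝ≥0∞}, b ≠ ∞ →
      (∀ᶠ r in 𝓝[>] (0 : ℝ), ρ (Metric.ball x r) ≤ b * μ (Metric.ball x r)) →
      ∀ᶠ r in 𝓝[>] (0 : ℝ), ρ (Metric.closedBall x r) ≤ b * μ (Metric.closedBall x r) := by
    intro μ ρ _ b hb hh
    obtain ⟨δ, hδ, hsub⟩ := (mem_nhdsGT_iff_exists_Ioo_subset).1 hh
    filter_upwards [Ioo_mem_nhdsGT hδ] with r hr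
    exact measure_closedBall_le_of_ball_le hb (fun s hs => hsub hs) hr
  intro c hc
  refine (key ENNReal.ofReal_ne_top ((h c hc).mono fun r hr => hr.1)).and ?_
  have : IsFiniteMeasure (ENNReal.ofReal c • ρ) := ρ.smul_finite ENNReal.ofReal_ne_top
  have := key (μ := ENNReal.ofReal c • ρ) (ρ := ENNReal.ofReal a • μ) ENNReal.one_ne_top
    ((h c hc).mono fun r hr => by simpa using hr.2)
  simpa using this

theorem eq_withDensity_of_asympScale_ball [SecondCountableTopology α] [HasBesicovitchCovering α]
    {μ ρ : Measure α} [IsFiniteMeasure μ] [IsFiniteMeasure ρ] {X : Set α} (hμX : μ Xᶜ = 0)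
    (hρX : ρ Xᶜ = 0) {D : α → ℝ} (hD : ∀ x ∈ X, 0 < D x)
    (hμ : ∀ x ∈ X, ∀ r > 0, 0 < μ (Metric.ball x r))
    (h : ∀ x ∈ X, AsympScale (𝓝[>] (0 : ℝ)) (D x) (fun r => ρ (Metric.ball x r))
      (fun r => μ (Metric.ball x r))) :
    ρ = μ.withDensity fun x => ENNReal.ofReal (D x) := by
  have hcl := fun x hx => (h x hx).closedBall
  have hac : ρ ≪ μ := by
    refine Measure.AbsolutelyContinuous.mk fun s _ hs => ?_
    have hk : ∀ k : ℕ, ρ (s ∩ X ∩ {x | D x < k}) = 0 := by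
      intro k
      have : IsFiniteMeasure (ENNReal.ofReal (2 * k) • μ) :=
        μ.smul_finite ENNReal.ofReal_ne_top
      have := (Besicovitch.vitaliFamily ρ).measure_le_of_frequently_le
        (ENNReal.ofReal (2 * k) • μ) Measure.AbsolutelyContinuous.rfl (s ∩ X ∩ {x | D x < k})
        fun x hx => ?_
      · refine le_antisymm (this.trans ?_) bot_le
        rw [Measure.smul_apply, measure_mono_null (fun x hx => hx.1.1) hs, smul_zero]
      · refine (Besicovitch.tendsto_filterAt ρ x).frequently ?_
        refine Eventually.frequently ?_
        filter_upwards [hcl x hx.1.2 2 one_lt_two] with r hr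
        refine hr.1.trans ?_
        rw [Measure.smul_apply, smul_eq_mul]
        gcongr
        exact le_of_lt hx.2
    have hsub : s ⊆ Xᶜ ∪ ⋃ k : ℕ, s ∩ X ∩ {x | D x < k} := by
      intro x hx
      by_cases hxX : x ∈ X
      · obtain ⟨k, hk⟩ := exists_nat_gt (D x)
        exact Or.inr (Set.mem_iUnion.2 ⟨k, ⟨hx, hxX⟩, hk⟩)
      · exact Or.inl hxX
    exact measure_mono_null hsub (measure_union_null hρX (measure_iUnion_null hk))
  rw [← Measure.withDensity_rnDeriv_eq ρ μ hac]
  refine withDensity_congr_ae ?_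
  have hX : ∀ᵐ x ∂μ, x ∈ X := hμX
  filter_upwards [hX, Besicovitch.ae_tendsto_rnDeriv ρ μ] with x hx hlim
  have hr := (hcl x hx).tendsto_ratio (hD x hx).le (by
    filter_upwards [self_mem_nhdsWithin] with r hr
    exact ⟨(hμ x hx r hr).trans_le (measure_mono Metric.ball_subset_closedBall),
      measure_lt_top _ _⟩)
  refine tendsto_nhds_unique hlim ((ENNReal.tendsto_ofReal hr).congr' ?_)
  filter_upwards [self_mem_nhdsWithin] with r hr
  have h0 : 0 < μ (Metric.closedBall x r) :=
    (hμ x hx r hr).trans_le (measure_mono Metric.ball_subset_closedBall)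
  rw [← ENNReal.toReal_div, ENNReal.ofReal_toReal]
  exact (ENNReal.div_lt_top (measure_ne_top _ _) h0.ne').ne

end Differentiation

section Polar

variable {n : ℕ} {K : Set (E n)} {ν : E n → E n}

theorem zero_mem_interior_of_centroid (hK : IsConvexBody K) (hcen : CentroidAtOrigin K) :
    (0 : E n) ∈ interior K := by
  by_contra h0
  obtain ⟨f, hf⟩ := geometric_hahn_banach_open_point hK.1.interior isOpen_interior h0
  rw [map_zero] at hf
  have hid : IntegrableOn (fun x : E n => x) K :=
    continuous_id.continuousOn.integrableOn_compact hK.2.1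
  have hle : ∀ x ∈ K, f x ≤ 0 := by
    intro x hx
    have : K ⊆ closure (interior K) := by
      rw [hK.1.closure_interior_eq_closure_of_nonempty_interior hK.2.2]
      exact subset_closure
    exact closure_minimal (fun y hy => (hf y hy).le)
      (isClosed_le f.continuous continuous_const) (this hx)
  have h1 : ∫ x in K, f x = 0 := by
    rw [ContinuousLinearMap.integral_comp_comm f hid, show ∫ x in K, x = 0 from hcen, map_zero]
  have h2 : ∫ x in K, -f x = 0 := by rw [integral_neg, h1, neg_zero]
  rw [setIntegral_eq_zero_iff_of_nonneg_ae] at h2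
  · have h3 : (volume.restrict K) (interior K) = 0 := by
      refine measure_mono_null (fun x hx => ?_) h2
      have := hf x hx
      simp only [Set.mem_compl_iff, Set.mem_ofPred_eq, Pi.zero_apply]
      linarith
    rw [Measure.restrict_apply isOpen_interior.measurableSet,
      Set.inter_eq_left.2 interior_subset] at h3
    exact (isOpen_interior.measure_pos volume hK.2.2).ne' h3
  · filter_upwards [ae_restrict_mem hK.2.1.measurableSet] with x hx
    simpa using hle x hx
  · exact (f.integrable_comp hid).neg

theorem exists_pos_le_inner (h0 : (0 : E n) ∈ interior K) :
    ∃ r > (0 : ℝ), ∀ u : E n, ‖u‖ = 1 → r • u ∈ K := by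
  obtain ⟨r, hr, hb⟩ := Metric.nhds_basis_closedBall.mem_iff.1 (mem_interior_iff_mem_nhds.1 h0)
  exact ⟨r, hr, fun u hu => hb (by simp [norm_smul, hu, abs_of_pos hr])⟩

theorem inner_pos_of_support (h0 : (0 : E n) ∈ interior K) {x u : E n} (hu : ‖u‖ = 1)
    (h : ∀ z ∈ K, ⟪z, u⟫ ≤ ⟪x, u⟫) : 0 < ⟪x, u⟫ := by
  obtain ⟨r, hr, hb⟩ := exists_pos_le_inner h0
  have := h _ (hb u hu)
  rw [real_inner_smul_left, real_inner_self_eq_norm_sq, hu] at this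
  linarith

/-- A point of `K` where a linear functional bounded by `1` on `K` attains `1` is a boundary
point. -/
theorem mem_frontier_of_inner_eq_one {x y : E n} (hx : x ∈ K) (h : ∀ z ∈ K, ⟪z, y⟫ ≤ 1)
    (hxy : ⟪x, y⟫ = 1) : x ∈ frontier K := by
  refine ⟨subset_closure hx, fun hi => ?_⟩
  have hc : Tendsto (fun t : ℝ => t • x) (𝓝[>] 1) (𝓝 x) := by
    have : ContinuousAt (fun t : ℝ => t • x) 1 := by fun_prop
    simpa [ContinuousAt] using this.tendsto.mono_left nhdsWithin_le_nhds
  obtain ⟨t, ht, ht1⟩ := ((hc.eventually (mem_interior_iff_mem_nhds.1 hi)).and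
    self_mem_nhdsWithin).exists
  have := h _ ht
  rw [real_inner_smul_left, hxy] at this
  have : (1 : ℝ) < t := ht1
  linarith

theorem eq_of_isOuterNormal (hK : IsConvexBody K) (h0 : (0 : E n) ∈ interior K)
    (hν : IsOuterNormal K ν) (hc : ContinuousOn ν (frontier K)) {v u : E n}
    (hv : v ∈ frontier K) (hu : ‖u‖ = 1) (h : ∀ z ∈ K, ⟪z, u⟫ ≤ ⟪v, u⟫) : u = ν v := by
  have hcl := hK.2.1.isClosed
  have hK0 : K ∈ 𝓝 (0 : E n) := mem_interior_iff_mem_nhds.1 h0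
  have hvK : v ∈ K := hcl.frontier_subset hv
  have hhv := inner_pos_of_support h0 (hν v hv).1 (hν v hv).2
  have hhu := inner_pos_of_support h0 hu h
  have key : ∀ w : E n, ⟪w, u⟫ * ⟪v, ν v⟫ ≤ ⟪w, ν v⟫ * ⟪v, u⟫ := by
    intro w
    set g : ℝ → ℝ := fun t => gauge K (v + t • w) with hg
    have hgc : Continuous g :=
      (continuous_gauge hK.1 hK0).comp (by fun_prop)
    have hg0 : g 0 = 1 := by
      simpa [hg] using (gauge_eq_one_iff_mem_frontier hK.1 hK0).2 hv
    set y : ℝ → E n := fun t => (g t)⁻¹ • (v + t • w) with hy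
    have hgt : Tendsto g (𝓝[>] 0) (𝓝 1) := by
      simpa [hg0] using (hgc.tendsto 0).mono_left nhdsWithin_le_nhds
    have hwt : Tendsto (fun t : ℝ => v + t • w) (𝓝[>] 0) (𝓝 v) := by
      have : Continuous (fun t : ℝ => v + t • w) := by fun_prop
      simpa using (this.tendsto 0).mono_left nhdsWithin_le_nhds
    have hyt : Tendsto y (𝓝[>] 0) (𝓝 v) := by
      have := (hgt.inv₀ one_ne_zero).smul hwt
      rwa [inv_one, one_smul] at this
    have hyf : ∀ᶠ t in 𝓝[>] 0, y t ∈ frontier K := by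
      filter_upwards [hgt.eventually_const_lt one_pos] with t ht
      rw [← gauge_eq_one_iff_mem_frontier hK.1 hK0, hy]
      simp only
      rw [gauge_smul_of_nonneg (inv_nonneg.2 ht.le), smul_eq_mul]
      exact inv_mul_cancel₀ ht.ne'
    have hνt : Tendsto (fun t => ν (y t)) (𝓝[>] 0) (𝓝 (ν v)) :=
      (hc v hv).tendsto.comp (tendsto_nhdsWithin_iff.2 ⟨hyt, hyf⟩)
    have hvt : Tendsto (fun t => ⟪v, ν (y t)⟫) (𝓝[>] 0) (𝓝 ⟪v, ν v⟫) :=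
      tendsto_const_nhds.inner hνt
    refine le_of_tendsto_of_tendsto (hvt.const_mul _)
      ((tendsto_const_nhds.inner hνt).mul_const _) ?_
    filter_upwards [hyf, hgt.eventually_const_lt one_pos, hvt.eventually_const_lt hhv,
      self_mem_nhdsWithin] with t hyft hgpos hvpos ht
    have ht : 0 < t := ht
    have e : g t • y t = v + t • w := smul_inv_smul₀ hgpos.ne' _
    have i1 := (hν _ hyft).2 v hvK
    have i2 := h _ (hcl.frontier_subset hyft)
    have e1 := congrArg (fun z => ⟪z, ν (y t)⟫) e
    have e2 := congrArg (fun z => ⟪z, u⟫) e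
    simp only [inner_add_left, real_inner_smul_left] at e1 e2
    have j1 : (g t - 1) * ⟪v, ν (y t)⟫ ≤ t * ⟪w, ν (y t)⟫ := by nlinarith
    have j2 : t * ⟪w, u⟫ ≤ (g t - 1) * ⟪v, u⟫ := by nlinarith
    have j3 := mul_le_mul_of_nonneg_right j2 hvpos.le
    have j4 := mul_le_mul_of_nonneg_right j1 hhu.le
    refine le_of_mul_le_mul_left ?_ ht
    linarith
  have hz : ⟪v, ν v⟫ • u - ⟪v, u⟫ • ν v = 0 := by
    have := key (⟪v, ν v⟫ • u - ⟪v, u⟫ • ν v)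
    rw [← inner_self_eq_zero (𝕜 := ℝ)]
    refine le_antisymm ?_ real_inner_self_nonneg
    rw [inner_sub_right, real_inner_smul_right, real_inner_smul_right]
    linarith
  rw [sub_eq_zero] at hz
  have hn := congrArg norm hz
  rw [norm_smul, norm_smul, hu, (hν v hv).1, mul_one, mul_one, Real.norm_of_nonneg hhv.le,
    Real.norm_of_nonneg hhu.le] at hn
  rw [← hn] at hz
  exact smul_right_injective _ hhv.ne' hz

/-- The boundary point of the polar body dual to a boundary point `x` with normal `ν x`. -/
def polarMap (ν : E n → E n) (x : E n) : E n := ⟪x, ν x⟫⁻¹ • ν x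

theorem isClosed_polarBody : IsClosed (polarBody K) := by
  have : polarBody K = ⋂ x ∈ K, {y | ⟪x, y⟫ ≤ 1} := by ext; simp [polarBody]
  rw [this]
  exact isClosed_biInter fun x _ => isClosed_le (by fun_prop) continuous_const

theorem isBounded_polarBody (h0 : (0 : E n) ∈ interior K) :
    Bornology.IsBounded (polarBody K) := by
  obtain ⟨r, hr, hb⟩ := exists_pos_le_inner h0
  refine (Metric.isBounded_closedBall (x := 0) (r := r⁻¹)).subset fun y hy => ?_
  rw [mem_closedBall_zero_iff]
  rcases eq_or_ne y 0 with rfl | hy0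
  · simp [hr.le]
  have := hy _ (hb (radialProj y) (norm_radialProj hy0))
  rw [radialProj, smul_smul, real_inner_smul_left, real_inner_self_eq_norm_sq] at this
  have hn : 0 < ‖y‖ := norm_pos_iff.2 hy0
  rw [← one_div, le_div_iff₀ hr]
  have e : r * ‖y‖⁻¹ * ‖y‖ ^ 2 = ‖y‖ * r := by field_simp
  linarith

theorem mem_interior_polarBody (hK : IsCompact K) {y : E n} {s : ℝ} (hs : s < 1)
    (h : ∀ z ∈ K, ⟪z, y⟫ ≤ s) : y ∈ interior (polarBody K) := by
  obtain ⟨R, hR⟩ := hK.isBounded.exists_norm_le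
  rw [mem_interior_iff_mem_nhds, Metric.mem_nhds_iff]
  have hR' : 0 < |R| + 1 := by positivity
  refine ⟨(1 - s) / (|R| + 1), div_pos (by linarith) hR', fun w hw z hz => ?_⟩
  rw [Metric.mem_ball, dist_eq_norm, lt_div_iff₀ hR'] at hw
  have h1 : ⟪z, w - y⟫ ≤ ‖z‖ * ‖w - y‖ := real_inner_le_norm _ _
  have h2 := h z hz
  have h3 := hR z hz
  have h4 := le_abs_self R
  rw [inner_sub_right] at h1
  nlinarith [norm_nonneg z, norm_nonneg (w - y)]

theorem mem_of_polarBody_polarBody (hK : IsConvexBody K) (h0 : (0 : E n) ∈ interior K) {v : E n}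
    (hv : ∀ y ∈ polarBody K, ⟪y, v⟫ ≤ 1) : v ∈ K := by
  by_contra hvK
  obtain ⟨f, s, hfs, hsv⟩ := geometric_hahn_banach_closed_point hK.1 hK.2.1.isClosed hvK
  have hs : 0 < s := by simpa using hfs 0 (interior_subset h0)
  set a := (InnerProductSpace.toDual ℝ (E n)).symm f with ha
  have hfa : ∀ z, f z = ⟪a, z⟫ := fun z => by simp [ha]
  have := hv (s⁻¹ • a) fun z hz => by
    rw [real_inner_smul_right, real_inner_comm, ← hfa, inv_mul_le_iff₀ hs, mul_one]
    exact (hfs z hz).le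
  rw [real_inner_smul_left, ← hfa, inv_mul_le_iff₀ hs, mul_one] at this
  linarith

theorem inner_polarMap_le (h0 : (0 : E n) ∈ interior K) (hν : IsOuterNormal K ν) {x z : E n}
    (hx : x ∈ frontier K) (hz : z ∈ K) : ⟪z, polarMap ν x⟫ ≤ 1 := by
  have hh := inner_pos_of_support h0 (hν x hx).1 (hν x hx).2
  rw [polarMap, real_inner_smul_right, inv_mul_le_iff₀ hh, mul_one]
  exact (hν x hx).2 z hz

theorem inner_polarMap_self (h0 : (0 : E n) ∈ interior K) (hν : IsOuterNormal K ν) {x : E n}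
    (hx : x ∈ frontier K) : ⟪x, polarMap ν x⟫ = 1 := by
  have hh := inner_pos_of_support h0 (hν x hx).1 (hν x hx).2
  rw [polarMap, real_inner_smul_right, inv_mul_cancel₀ hh.ne']

theorem norm_polarMap (h0 : (0 : E n) ∈ interior K) (hν : IsOuterNormal K ν) {x : E n}
    (hx : x ∈ frontier K) : ‖polarMap ν x‖ = ⟪x, ν x⟫⁻¹ := by
  have hh := inner_pos_of_support h0 (hν x hx).1 (hν x hx).2
  rw [polarMap, norm_smul, (hν x hx).1, mul_one, Real.norm_of_nonneg (by positivity)]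

theorem radialProj_polarMap (h0 : (0 : E n) ∈ interior K) (hν : IsOuterNormal K ν) {x : E n}
    (hx : x ∈ frontier K) : radialProj (polarMap ν x) = ν x := by
  have hh := inner_pos_of_support h0 (hν x hx).1 (hν x hx).2
  rw [radialProj, norm_polarMap h0 hν hx, polarMap, inv_inv, smul_inv_smul₀ hh.ne']

theorem polarMap_mem_frontier (hK : IsConvexBody K) (h0 : (0 : E n) ∈ interior K)
    (hν : IsOuterNormal K ν) {x : E n} (hx : x ∈ frontier K) :
    polarMap ν x ∈ frontier (polarBody K) := by
  have hxK : x ∈ K := hK.2.1.isClosed.frontier_subset hx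
  refine mem_frontier_of_inner_eq_one (y := x) (fun z hz => inner_polarMap_le h0 hν hx hz)
    (fun y hy => ?_) ?_
  · rw [real_inner_comm]; exact hy x hxK
  · rw [real_inner_comm]; exact inner_polarMap_self h0 hν hx

theorem bijOn_polarMap (hK : IsConvexBody K) (h0 : (0 : E n) ∈ interior K)
    (hν : IsOuterNormal K ν) (hbij : BijOn ν (frontier K) (Metric.sphere 0 1)) :
    BijOn (polarMap ν) (frontier K) (frontier (polarBody K)) := by
  refine ⟨fun x hx => polarMap_mem_frontier hK h0 hν hx, fun x hx y hy hxy => ?_, fun y hy => ?_⟩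
  · have := congrArg radialProj hxy
    rw [radialProj_polarMap h0 hν hx, radialProj_polarMap h0 hν hy] at this
    exact hbij.injOn hx hy this
  · have hyK : y ∈ polarBody K := isClosed_polarBody.frontier_subset hy
    obtain ⟨z₀, hz₀, hmax⟩ := hK.2.1.exists_isMaxOn ⟨0, interior_subset h0⟩
      (f := fun z => ⟪z, y⟫) (by fun_prop)
    have hmax' : ∀ z ∈ K, ⟪z, y⟫ ≤ ⟪z₀, y⟫ := fun z hz => hmax hz
    have h1 : ⟪z₀, y⟫ = 1 := by
      refine le_antisymm (hyK z₀ hz₀) (not_lt.1 fun hlt => ?_)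
      exact hy.2 (mem_interior_polarBody hK.2.1 hlt hmax')
    have hy0 : y ≠ 0 := by rintro rfl; simp at h1
    have hyn : 0 < ‖y‖ := norm_pos_iff.2 hy0
    obtain ⟨x, hx, hxy⟩ := hbij.surjOn
      (show radialProj y ∈ Metric.sphere 0 1 by simpa using norm_radialProj hy0)
    have hxK : x ∈ K := hK.2.1.isClosed.frontier_subset hx
    have h2 := (hν x hx).2 z₀ hz₀
    rw [hxy, radialProj, real_inner_smul_right, real_inner_smul_right, h1] at h2
    have h3 : ⟪x, y⟫ = 1 := le_antisymm (hyK x hxK) (le_of_mul_le_mul_left h2 (by positivity))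
    refine ⟨x, hx, ?_⟩
    rw [polarMap, hxy, radialProj, real_inner_smul_right, h3, mul_one, inv_inv,
      smul_inv_smul₀ hyn.ne']

theorem continuousOn_polarMap (h0 : (0 : E n) ∈ interior K) (hν : IsOuterNormal K ν)
    (hc : ContinuousOn ν (frontier K)) : ContinuousOn (polarMap ν) (frontier K) :=
  ((continuousOn_id.inner hc).inv₀ fun x hx =>
    (inner_pos_of_support h0 (hν x hx).1 (hν x hx).2).ne').smul hc

theorem normal_polarMap {ν' : E n → E n} (hK : IsConvexBody K) (h0 : (0 : E n) ∈ interior K)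
    (hν : IsOuterNormal K ν) (hc : ContinuousOn ν (frontier K))
    (hbij : BijOn ν (frontier K) (Metric.sphere 0 1)) (hν' : IsOuterNormal (polarBody K) ν')
    {x : E n} (hx : x ∈ frontier K) : ν' (polarMap ν x) = radialProj x := by
  obtain ⟨R, hR0, hR⟩ := hK.2.1.isBounded.exists_pos_norm_le
  have h0' : (0 : E n) ∈ interior (polarBody K) :=
    mem_interior_polarBody hK.2.1 zero_lt_one (by simp)
  set y := polarMap ν x with hy
  obtain ⟨hv1, hv⟩ := hν' y (polarMap_mem_frontier hK h0 hν hx)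
  have hs := inner_pos_of_support h0' hv1 hv
  set s := ⟪y, ν' y⟫ with hsdef
  have hvy : ⟪s⁻¹ • ν' y, y⟫ = 1 := by
    rw [real_inner_smul_left, real_inner_comm, inv_mul_cancel₀ hs.ne']
  have hvK : s⁻¹ • ν' y ∈ K := mem_of_polarBody_polarBody hK h0 fun z hz => by
    rw [real_inner_smul_right, inv_mul_le_iff₀ hs, mul_one]
    exact hv z hz
  have hle : ∀ z ∈ K, ⟪z, y⟫ ≤ 1 := fun z hz => inner_polarMap_le h0 hν hx hz
  have hvf : s⁻¹ • ν' y ∈ frontier K := mem_frontier_of_inner_eq_one hvK hle hvy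
  have hh := inner_pos_of_support h0 (hν x hx).1 (hν x hx).2
  have hyν : ν x = ⟪x, ν x⟫ • y := by rw [hy, polarMap, smul_inv_smul₀ hh.ne']
  have heq := eq_of_isOuterNormal hK h0 hν hc hvf (hν x hx).1 fun z hz => by
    rw [hyν, real_inner_smul_right, real_inner_smul_right, hvy]
    gcongr
    exact hle z hz
  have hxv := hbij.injOn hx hvf heq
  rw [hxv, radialProj, norm_smul, hv1, mul_one, norm_inv, Real.norm_of_nonneg hs.le, inv_inv,
    smul_inv_smul₀ hs.ne']

theorem continuousOn_invFunOn {α β : Type*} [TopologicalSpace α] [Nonempty α]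
    [TopologicalSpace β] [T2Space β]
    {f : α → β} {s : Set α} {t : Set β} (hs : IsCompact s) (hf : ContinuousOn f s)
    (hb : BijOn f s t) : ContinuousOn (Function.invFunOn f s) t := by
  rw [continuousOn_iff_isClosed]
  intro c hc
  refine ⟨f '' (s ∩ c), ((hs.inter_right hc).image_of_continuousOn
    (hf.mono inter_subset_left)).isClosed, ?_⟩
  ext y
  constructor
  · rintro ⟨hyc, hyt⟩
    exact ⟨⟨_, ⟨Function.invFunOn_mem (hb.surjOn hyt), hyc⟩,
      Function.invFunOn_eq (hb.surjOn hyt)⟩, hyt⟩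
  · rintro ⟨⟨x, ⟨hx, hxc⟩, rfl⟩, hyt⟩
    refine ⟨?_, hyt⟩
    rwa [Set.mem_preimage, hb.injOn.leftInvOn_invFunOn hx]

end Polar

theorem asympScale_bdMeasure_radialProj {n : ℕ} {X : Set (E n)} {ν : E n → E n}
    (hsupp : ∀ x ∈ X, ∀ y ∈ X, ⟪y, ν x⟫ ≤ ⟪x, ν x⟫) {x₀ : E n}
    (hcont : ContinuousWithinAt ν X x₀) (hν : ‖ν x₀‖ = 1) (hpos : 0 < ⟪x₀, ν x₀⟫)
    {ι : Type*} {l : Filter ι} {A : ι → Set (E n)} (hA : Tendsto A l (𝓝[X] x₀).smallSets) :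
    AsympScale l (⟪x₀, ν x₀⟫ / ‖x₀‖ ^ n) (fun i => bdMeasure n (radialProj '' A i))
      (fun i => bdMeasure n (A i)) := by
  intro c hc
  obtain ⟨t, ht, h⟩ := exists_nhds_bdMeasure_radialProj hsupp hcont hν hpos hc
  filter_upwards [tendsto_smallSets_iff.1 hA _ (inter_mem_nhdsWithin X ht)] with i hi using h _ hi

section Dual

variable {n : ℕ} {K : Set (E n)} {ν ν' : E n → E n} {κ : E n → ℝ}

/-- A body of class `C²₊` containing the origin in its interior, together with an outer normal
map of its polar body. -/
structure IsDualPair (K : Set (E n)) (ν ν' : E n → E n) (κ : E n → ℝ) : Prop where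
  body : IsConvexBody K
  zero_mem : (0 : E n) ∈ interior K
  normal : IsOuterNormal K ν
  continuousOn_normal : ContinuousOn ν (frontier K)
  continuousOn_curvature : ContinuousOn κ (frontier K)
  bijOn_normal : BijOn ν (frontier K) (Metric.sphere 0 1)
  curvature : ∀ x ∈ frontier K, IsGaussCurvatureAt K ν x (κ x)
  curvature_pos : ∀ x ∈ frontier K, 0 < κ x
  polar_normal : IsOuterNormal (polarBody K) ν'

/-- The inverse of `polarMap`. -/
def polarInv (K : Set (E n)) (ν : E n → E n) : E n → E n :=
  Function.invFunOn (polarMap ν) (frontier K)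

/-- The Jacobian of `polarMap`. -/
def polarDensity (ν : E n → E n) (κ : E n → ℝ) (x : E n) : ℝ :=
  (‖x‖⁻¹ * ⟪x, ν x⟫ ^ n)⁻¹ * κ x

namespace IsDualPair

theorem isCompact_frontier (h : IsDualPair K ν ν' κ) : IsCompact (frontier K) :=
  h.body.2.1.of_isClosed_subset isClosed_frontier h.body.2.1.isClosed.frontier_subset

theorem isCompact_frontier_polar (h : IsDualPair K ν ν' κ) :
    IsCompact (frontier (polarBody K)) :=
  (Metric.isCompact_of_isClosed_isBounded isClosed_polarBody
    (isBounded_polarBody h.zero_mem)).of_isClosed_subset isClosed_frontier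
    isClosed_polarBody.frontier_subset

theorem bijOn_polarMap (h : IsDualPair K ν ν' κ) :
    BijOn (polarMap ν) (frontier K) (frontier (polarBody K)) :=
  LpAffine.bijOn_polarMap h.body h.zero_mem h.normal h.bijOn_normal

theorem continuousOn_polarMap (h : IsDualPair K ν ν' κ) :
    ContinuousOn (polarMap ν) (frontier K) :=
  LpAffine.continuousOn_polarMap h.zero_mem h.normal h.continuousOn_normal

theorem continuousOn_polarInv (h : IsDualPair K ν ν' κ) :
    ContinuousOn (polarInv K ν) (frontier (polarBody K)) :=
  continuousOn_invFunOn h.isCompact_frontier h.continuousOn_polarMap h.bijOn_polarMap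

theorem polarInv_polarMap (h : IsDualPair K ν ν' κ) {x : E n} (hx : x ∈ frontier K) :
    polarInv K ν (polarMap ν x) = x :=
  h.bijOn_polarMap.injOn.leftInvOn_invFunOn hx

theorem polarInv_mem (h : IsDualPair K ν ν' κ) {y : E n} (hy : y ∈ frontier (polarBody K)) :
    polarInv K ν y ∈ frontier K :=
  Function.invFunOn_mem (h.bijOn_polarMap.surjOn hy)

theorem polarMap_polarInv (h : IsDualPair K ν ν' κ) {y : E n}
    (hy : y ∈ frontier (polarBody K)) : polarMap ν (polarInv K ν y) = y :=
  Function.invFunOn_eq (h.bijOn_polarMap.surjOn hy)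

theorem inner_pos (h : IsDualPair K ν ν' κ) {x : E n} (hx : x ∈ frontier K) : 0 < ⟪x, ν x⟫ :=
  inner_pos_of_support h.zero_mem (h.normal x hx).1 (h.normal x hx).2

theorem norm_pos (h : IsDualPair K ν ν' κ) {x : E n} (hx : x ∈ frontier K) : 0 < ‖x‖ := by
  refine norm_pos_iff.2 ?_
  rintro rfl
  simpa using h.inner_pos hx

theorem polarDensity_pos (h : IsDualPair K ν ν' κ) {x : E n} (hx : x ∈ frontier K) :
    0 < polarDensity ν κ x := by
  have h1 := h.inner_pos hx
  have h2 := h.norm_pos hx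
  have h3 := h.curvature_pos x hx
  unfold polarDensity
  positivity

theorem continuousOn_polarDensity (h : IsDualPair K ν ν' κ) :
    ContinuousOn (polarDensity ν κ) (frontier K) := by
  have hi : ContinuousOn (fun x => ⟪x, ν x⟫) (frontier K) :=
    continuousOn_id.inner h.continuousOn_normal
  refine ContinuousOn.mul (ContinuousOn.inv₀ (ContinuousOn.mul
    (continuous_norm.continuousOn.inv₀ fun x hx => (h.norm_pos hx).ne') (hi.pow n))
    fun x hx => ?_) h.continuousOn_curvature
  have h1 := h.inner_pos hx
  have h2 := h.norm_pos hx
  positivity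

theorem continuousOn_polar_normal (h : IsDualPair K ν ν' κ) :
    ContinuousOn ν' (frontier (polarBody K)) := by
  have hr : ContinuousOn (radialProj : E n → E n) (frontier K) :=
    (continuous_norm.continuousOn.inv₀ fun x hx => (h.norm_pos hx).ne').smul continuousOn_id
  refine (hr.comp h.continuousOn_polarInv fun y hy => h.polarInv_mem hy).congr fun y hy => ?_
  have := normal_polarMap h.body h.zero_mem h.normal h.continuousOn_normal h.bijOn_normal
    h.polar_normal (h.polarInv_mem hy)
  rwa [h.polarMap_polarInv hy] at this

theorem normal_polarMap (h : IsDualPair K ν ν' κ) {x : E n} (hx : x ∈ frontier K) :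
    ν' (polarMap ν x) = radialProj x :=
  LpAffine.normal_polarMap h.body h.zero_mem h.normal h.continuousOn_normal h.bijOn_normal
    h.polar_normal hx

theorem inner_normal_polarMap (h : IsDualPair K ν ν' κ) {x : E n} (hx : x ∈ frontier K) :
    ⟪polarMap ν x, ν' (polarMap ν x)⟫ = ‖x‖⁻¹ := by
  rw [h.normal_polarMap hx, radialProj, real_inner_smul_right, real_inner_comm,
    inner_polarMap_self h.zero_mem h.normal hx, mul_one]

theorem asympScale_radialProj (h : IsDualPair K ν ν' κ) {x : E n} (hx : x ∈ frontier K)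
    {ι : Type*} {l : Filter ι} {A : ι → Set (E n)}
    (hA : Tendsto A l (𝓝[frontier K] x).smallSets) :
    AsympScale l (⟪x, ν x⟫ / ‖x‖ ^ n) (fun i => bdMeasure n (radialProj '' A i))
      (fun i => bdMeasure n (A i)) :=
  asympScale_bdMeasure_radialProj
    (fun x hx y hy => (h.normal x hx).2 y (h.body.2.1.isClosed.frontier_subset hy))
    (h.continuousOn_normal x hx) (h.normal x hx).1 (h.inner_pos hx) hA

theorem asympScale_radialProj_polar (h : IsDualPair K ν ν' κ) {x : E n} (hx : x ∈ frontier K)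
    {ι : Type*} {l : Filter ι} {A : ι → Set (E n)}
    (hA : Tendsto A l (𝓝[frontier (polarBody K)] (polarMap ν x)).smallSets) :
    AsympScale l (‖x‖⁻¹ * ⟪x, ν x⟫ ^ n) (fun i => bdMeasure n (radialProj '' A i))
      (fun i => bdMeasure n (A i)) := by
  have hy := h.bijOn_polarMap.mapsTo hx
  have hx' := h.norm_pos hx
  have := asympScale_bdMeasure_radialProj
    (fun x hx y hy => (h.polar_normal x hx).2 y (isClosed_polarBody.frontier_subset hy))
    (h.continuousOn_polar_normal _ hy) (h.polar_normal _ hy).1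
    (by rw [h.inner_normal_polarMap hx]; positivity) hA
  rwa [h.inner_normal_polarMap hx, norm_polarMap h.zero_mem h.normal hx, inv_pow,
    div_inv_eq_mul] at this

theorem asympScale_normal (h : IsDualPair K ν ν' κ) {x : E n} (hx : x ∈ frontier K) :
    AsympScale (𝓝[>] (0 : ℝ)) (κ x)
      (fun r => bdMeasure n (ν '' (frontier K ∩ Metric.ball x r)))
      (fun r => bdMeasure n (frontier K ∩ Metric.ball x r)) :=
  .of_tendsto_ratio (h.curvature_pos x hx) (h.curvature x hx)

theorem eventually_pos_lt_top (h : IsDualPair K ν ν' κ) {x : E n} (hx : x ∈ frontier K) :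
    ∀ᶠ r in 𝓝[>] (0 : ℝ), (0 < bdMeasure n (frontier K ∩ Metric.ball x r) ∧
      bdMeasure n (frontier K ∩ Metric.ball x r) < ∞) ∧
      bdMeasure n (ν '' (frontier K ∩ Metric.ball x r)) < ∞ := by
  filter_upwards [(h.curvature x hx).eventually_const_lt (h.curvature_pos x hx)] with r hr
  rw [← ENNReal.toReal_pos_iff]
  have h1 : 0 < (bdMeasure n (frontier K ∩ Metric.ball x r)).toReal :=
    ENNReal.toReal_nonneg.lt_of_ne fun h0 => by simp [← h0] at hr
  refine ⟨h1, (ENNReal.toReal_pos_iff.1 ?_).2⟩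
  exact ENNReal.toReal_nonneg.lt_of_ne fun h0 => by simp [← h0] at hr

theorem measure_ball_pos (h : IsDualPair K ν ν' κ) {x : E n} (hx : x ∈ frontier K) {r : ℝ}
    (hr : 0 < r) : 0 < bdMeasure n (frontier K ∩ Metric.ball x r) := by
  obtain ⟨s, hs, hsr⟩ := ((h.eventually_pos_lt_top hx).and (Ioo_mem_nhdsGT hr)).exists
  refine hs.1.1.trans_le (measure_mono ?_)
  gcongr
  exact hsr.2.le

theorem measure_frontier_lt_top (h : IsDualPair K ν ν' κ) : bdMeasure n (frontier K) < ∞ := by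
  refine h.isCompact_frontier.measure_lt_top_of_nhdsWithin fun x hx => ?_
  obtain ⟨s, hs, hs0⟩ := ((h.eventually_pos_lt_top hx).and self_mem_nhdsWithin).exists
  exact ⟨_, inter_mem_nhdsWithin _ (Metric.ball_mem_nhds x hs0), hs.1.2⟩

theorem radialProj_image_polarMap (h : IsDualPair K ν ν' κ) {A : Set (E n)}
    (hA : A ⊆ frontier K) : radialProj '' (polarMap ν '' A) = ν '' A := by
  rw [Set.image_image]
  exact Set.image_congr fun x hx => radialProj_polarMap h.zero_mem h.normal (hA hx)

theorem normal_image_polarMap (h : IsDualPair K ν ν' κ) {A : Set (E n)}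
    (hA : A ⊆ frontier K) : ν' '' (polarMap ν '' A) = radialProj '' A := by
  rw [Set.image_image]
  exact Set.image_congr fun x hx => h.normal_polarMap (hA hx)

theorem inter_preimage_polarInv (h : IsDualPair K ν ν' κ) (A : Set (E n)) :
    polarInv K ν ⁻¹' A ∩ frontier (polarBody K) = polarMap ν '' (frontier K ∩ A) := by
  ext y
  constructor
  · rintro ⟨hyA, hy⟩
    exact ⟨_, ⟨h.polarInv_mem hy, hyA⟩, h.polarMap_polarInv hy⟩
  · rintro ⟨x, ⟨hx, hxA⟩, rfl⟩
    exact ⟨by rwa [Set.mem_preimage, h.polarInv_polarMap hx], h.bijOn_polarMap.mapsTo hx⟩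

theorem tendsto_ball_smallSets {α : Type*} [PseudoMetricSpace α] (s : Set α) (x : α) :
    Tendsto (fun r : ℝ => s ∩ Metric.ball x r) (𝓝[>] 0) (𝓝[s] x).smallSets := by
  rw [tendsto_smallSets_iff]
  intro t ht
  obtain ⟨ε, hε, hs⟩ := Metric.mem_nhdsWithin_iff.1 ht
  filter_upwards [Ioo_mem_nhdsGT hε] with r hr
  rw [inter_comm]
  exact (inter_subset_inter_left s (Metric.ball_subset_ball hr.2.le)).trans hs

theorem tendsto_image_polarMap (h : IsDualPair K ν ν' κ) {x : E n} (hx : x ∈ frontier K)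
    {ι : Type*} {l : Filter ι} {A : ι → Set (E n)}
    (hA : Tendsto A l (𝓝[frontier K] x).smallSets) :
    Tendsto (fun i => polarMap ν '' A i) l
      (𝓝[frontier (polarBody K)] (polarMap ν x)).smallSets :=
  (Tendsto.image_smallSets <| tendsto_nhdsWithin_iff.2 ⟨h.continuousOn_polarMap x hx,
    eventually_mem_nhdsWithin.mono fun _ hz => h.bijOn_polarMap.mapsTo hz⟩).comp hA

theorem tendsto_image_polarInv (h : IsDualPair K ν ν' κ) {x : E n} (hx : x ∈ frontier K)
    {ι : Type*} {l : Filter ι} {A : ι → Set (E n)}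
    (hA : Tendsto A l (𝓝[frontier (polarBody K)] (polarMap ν x)).smallSets) :
    Tendsto (fun i => polarInv K ν '' A i) l (𝓝[frontier K] x).smallSets := by
  have := h.continuousOn_polarInv _ (h.bijOn_polarMap.mapsTo hx)
  rw [ContinuousWithinAt, h.polarInv_polarMap hx] at this
  exact (Tendsto.image_smallSets <| tendsto_nhdsWithin_iff.2 ⟨this,
    eventually_mem_nhdsWithin.mono fun _ hz => h.polarInv_mem hz⟩).comp hA

theorem polarMap_image_polarInv (h : IsDualPair K ν ν' κ) {A : Set (E n)}
    (hA : A ⊆ frontier (polarBody K)) : polarMap ν '' (polarInv K ν '' A) = A := by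
  rw [Set.image_image]
  exact (Set.image_congr fun y hy => h.polarMap_polarInv (hA hy)).trans (Set.image_id' A)

theorem polarInv_image_subset (h : IsDualPair K ν ν' κ) {A : Set (E n)}
    (hA : A ⊆ frontier (polarBody K)) : polarInv K ν '' A ⊆ frontier K := by
  rintro _ ⟨y, hy, rfl⟩
  exact h.polarInv_mem (hA hy)

theorem measure_frontier_polar_lt_top (h : IsDualPair K ν ν' κ) :
    bdMeasure n (frontier (polarBody K)) < ∞ := by
  refine h.isCompact_frontier_polar.measure_lt_top_of_nhdsWithin fun y hy => ?_
  obtain ⟨x, hx, rfl⟩ := h.bijOn_polarMap.surjOn hy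
  have hA := tendsto_ball_smallSets (frontier (polarBody K)) (polarMap ν x)
  obtain ⟨s, hs, hs0⟩ := ((h.eventually_pos_lt_top hx).and self_mem_nhdsWithin).exists
  obtain ⟨r, ⟨hr1, hr2⟩, hr0⟩ := (((h.asympScale_radialProj_polar hx hA 2 one_lt_two).and
    (tendsto_smallSets_iff.1 (h.tendsto_image_polarInv hx hA) _
      (inter_mem_nhdsWithin _ (Metric.ball_mem_nhds x hs0)))).and self_mem_nhdsWithin).exists
  refine ⟨_, inter_mem_nhdsWithin _ (Metric.ball_mem_nhds _ hr0), ?_⟩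
  set A := frontier (polarBody K) ∩ Metric.ball (polarMap ν x) r
  have hAY : A ⊆ frontier (polarBody K) := inter_subset_left
  have hJ : 0 < ‖x‖⁻¹ * ⟪x, ν x⟫ ^ n := by
    have := h.inner_pos hx
    have := h.norm_pos hx
    positivity
  have himg : bdMeasure n (radialProj '' A) < ∞ := by
    rw [← h.polarMap_image_polarInv hAY, h.radialProj_image_polarMap (h.polarInv_image_subset hAY)]
    exact (measure_mono (image_mono hr2)).trans_lt hs.2
  have := hr1.2.trans_lt (ENNReal.mul_lt_top ENNReal.ofReal_lt_top himg)
  exact ENNReal.lt_top_of_mul_ne_top_right this.ne (ENNReal.ofReal_pos.2 hJ).ne'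

theorem aemeasurable_polarInv (h : IsDualPair K ν ν' κ) :
    AEMeasurable (polarInv K ν) ((bdMeasure n).restrict (frontier (polarBody K))) :=
  h.continuousOn_polarInv.aemeasurable isClosed_frontier.measurableSet

theorem map_polarInv_apply (h : IsDualPair K ν ν' κ) {A : Set (E n)} (hA : MeasurableSet A) :
    ((bdMeasure n).restrict (frontier (polarBody K))).map (polarInv K ν) A =
      bdMeasure n (polarMap ν '' (frontier K ∩ A)) := by
  rw [Measure.map_apply_of_aemeasurable h.aemeasurable_polarInv hA,
    Measure.restrict_apply' isClosed_frontier.measurableSet, h.inter_preimage_polarInv]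

/-- The change of variables formula for `polarMap`. -/
theorem map_polarInv (h : IsDualPair K ν ν' κ) :
    ((bdMeasure n).restrict (frontier (polarBody K))).map (polarInv K ν) =
      ((bdMeasure n).restrict (frontier K)).withDensity
        fun x => ENNReal.ofReal (polarDensity ν κ x) := by
  have hX : MeasurableSet (frontier K) := isClosed_frontier.measurableSet
  have : IsFiniteMeasure ((bdMeasure n).restrict (frontier K)) :=
    ⟨by simpa using h.measure_frontier_lt_top⟩
  have : IsFiniteMeasure ((bdMeasure n).restrict (frontier (polarBody K))) :=
    ⟨by simpa using h.measure_frontier_polar_lt_top⟩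
  refine eq_withDensity_of_asympScale_ball (X := frontier K) (by simp [hX]) ?_
    (fun x hx => h.polarDensity_pos hx) (fun x hx r hr => ?_) fun x hx => ?_
  · rw [h.map_polarInv_apply hX.compl]
    simp
  · rw [Measure.restrict_apply' hX, inter_comm]
    exact h.measure_ball_pos hx hr
  · have hA := tendsto_ball_smallSets (frontier K) x
    have h1 := h.asympScale_radialProj_polar hx (h.tendsto_image_polarMap hx hA)
    simp only [h.radialProj_image_polarMap inter_subset_left] at h1
    have hJ : 0 < ‖x‖⁻¹ * ⟪x, ν x⟫ ^ n := by
      have := h.inner_pos hx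
      have := h.norm_pos hx
      positivity
    have h2 := (h1.symm hJ).trans (h.asympScale_normal hx) (by positivity)
    simpa only [h.map_polarInv_apply Metric.isOpen_ball.measurableSet,
      Measure.restrict_apply' hX, inter_comm _ (frontier K), polarDensity] using h2

theorem asympScale_polarMap (h : IsDualPair K ν ν' κ) {x : E n} (hx : x ∈ frontier K)
    {ι : Type*} {l : Filter ι} {A : ι → Set (E n)} (hAm : ∀ i, MeasurableSet (A i))
    (hA : Tendsto A l (𝓝[frontier K] x).smallSets) :
    AsympScale l (polarDensity ν κ x) (fun i => bdMeasure n (polarMap ν '' A i))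
      (fun i => bdMeasure n (A i)) := by
  intro c hc
  have hX : MeasurableSet (frontier K) := isClosed_frontier.measurableSet
  have hD := h.polarDensity_pos hx
  have hc0 : 0 < c := by linarith
  have h1 : polarDensity ν κ x < c * polarDensity ν κ x := by nlinarith
  have h2 : polarDensity ν κ x / c < polarDensity ν κ x := by rw [div_lt_iff₀ hc0]; nlinarith
  have hc := h.continuousOn_polarDensity x hx
  have hev := tendsto_smallSets_iff.1 hA _
    (((hc.eventually_lt_const h1).and (hc.eventually_const_lt h2)).and self_mem_nhdsWithin)
  filter_upwards [hev] with i hi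
  have hAX : A i ⊆ frontier K := fun z hz => (hi hz).2
  have e := h.map_polarInv_apply (hAm i)
  rw [h.map_polarInv, withDensity_apply _ (hAm i), Measure.restrict_restrict (hAm i),
    inter_eq_left.2 hAX, inter_eq_right.2 hAX] at e
  rw [← e]
  constructor
  · rw [← setLIntegral_const]
    exact setLIntegral_mono' (hAm i) fun z hz => ENNReal.ofReal_le_ofReal (hi hz).1.1.le
  · rw [← setLIntegral_const, ← lintegral_const_mul' _ _ ENNReal.ofReal_ne_top]
    refine setLIntegral_mono' (hAm i) fun z hz => ?_
    rw [← ENNReal.ofReal_mul hc0.le]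
    refine ENNReal.ofReal_le_ofReal ?_
    have := (hi hz).1.2
    rw [div_lt_iff₀ hc0] at this
    linarith

/-- The Gauss curvature of the polar body at the dual boundary point. -/
theorem isGaussCurvatureAt_polar (h : IsDualPair K ν ν' κ) {x : E n} (hx : x ∈ frontier K) :
    IsGaussCurvatureAt (polarBody K) ν' (polarMap ν x)
      (⟪x, ν x⟫ / ‖x‖ ^ n * (polarDensity ν κ x)⁻¹) := by
  set B : ℝ → Set (E n) := fun r => frontier (polarBody K) ∩ Metric.ball (polarMap ν x) r with hB
  have hBY : ∀ r, B r ⊆ frontier (polarBody K) := fun r => inter_subset_left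
  have hBl : Tendsto B (𝓝[>] 0) (𝓝[frontier (polarBody K)] (polarMap ν x)).smallSets :=
    tendsto_ball_smallSets _ _
  have hA := h.tendsto_image_polarInv hx hBl
  have hAm : ∀ r, MeasurableSet (polarInv K ν '' B r) := by
    intro r
    obtain ⟨u, hu, hur⟩ := continuousOn_iff'.1 h.continuousOn_polarMap
      (Metric.ball (polarMap ν x) r) Metric.isOpen_ball
    have : polarInv K ν '' B r = u ∩ frontier K := by
      rw [← hur]
      ext z
      constructor
      · rintro ⟨y, ⟨hy, hyr⟩, rfl⟩
        exact ⟨by rwa [Set.mem_preimage, h.polarMap_polarInv hy], h.polarInv_mem hy⟩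
      · rintro ⟨hzr, hz⟩
        exact ⟨_, ⟨h.bijOn_polarMap.mapsTo hz, hzr⟩, h.polarInv_polarMap hz⟩
    rw [this]
    exact hu.measurableSet.inter isClosed_frontier.measurableSet
  have hJ : 0 ≤ ⟪x, ν x⟫ / ‖x‖ ^ n := by
    have := h.inner_pos hx
    positivity
  have hD := h.polarDensity_pos hx
  have h1 := h.asympScale_radialProj hx hA
  have h2 := h.asympScale_polarMap hx hAm hA
  simp only [← h.normal_image_polarMap (h.polarInv_image_subset (hBY _)),
    h.polarMap_image_polarInv (hBY _)] at h1 h2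
  refine (h1.trans (h2.symm hD) hJ).tendsto_ratio (by positivity) ?_
  filter_upwards [h2 2 one_lt_two, self_mem_nhdsWithin] with r hr hr0
  refine ⟨?_, (measure_mono (hBY r)).trans_lt h.measure_frontier_polar_lt_top⟩
  have hpos : 0 < bdMeasure n (polarInv K ν '' B r) := by
    have := (h.continuousOn_polarMap x hx).eventually (Metric.ball_mem_nhds _ hr0)
    obtain ⟨ε, hε, hs⟩ := Metric.mem_nhdsWithin_iff.1 this
    refine (h.measure_ball_pos hx hε).trans_le (measure_mono ?_)
    rintro z ⟨hz, hzε⟩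
    exact ⟨_, ⟨h.bijOn_polarMap.mapsTo hz, hs ⟨hzε, hz⟩⟩, h.polarInv_polarMap hz⟩
  refine pos_iff_ne_zero.2 fun h0 => ?_
  have := hr.2
  rw [h0, mul_zero] at this
  exact (ENNReal.mul_pos (ENNReal.ofReal_pos.2 hD).ne' hpos.ne').not_ge this

end IsDualPair

end Dual

theorem mul_rpow_div_rpow_dual {n : ℕ} (hn : n ≠ 0) {p : ℝ} (hp : p ≠ -(n : ℝ)) (hp0 : p ≠ 0)
    {r t k : ℝ} (hr : 0 < r) (ht : 0 < t) (hk : 0 < k) :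
    (r⁻¹ * t ^ n)⁻¹ * k *
        ((t / r ^ n * ((r⁻¹ * t ^ n)⁻¹ * k)⁻¹) ^ ((n : ℝ) ^ 2 / p / (n + (n : ℝ) ^ 2 / p)) /
          r⁻¹ ^ (n * ((n : ℝ) ^ 2 / p - 1) / (n + (n : ℝ) ^ 2 / p))) =
      k ^ (p / (n + p)) / t ^ (n * (p - 1) / (n + p)) := by
  have hn' : (n : ℝ) ≠ 0 := Nat.cast_ne_zero.2 hn
  have hs : (n : ℝ) + p ≠ 0 := fun h => hp (by linarith)
  have hq : (n : ℝ) + (n : ℝ) ^ 2 / p = n * (n + p) / p := by field_simp; ring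
  have e1 : (n : ℝ) ^ 2 / p / (n + (n : ℝ) ^ 2 / p) = n / (n + p) := by rw [hq]; field_simp
  have e2 : n * ((n : ℝ) ^ 2 / p - 1) / (n + (n : ℝ) ^ 2 / p) = (n ^ 2 - p) / (n + p) := by
    rw [hq]; field_simp
  rw [e1, e2]
  refine Real.log_injOn_pos (Set.mem_Ioi.2 (by positivity)) (Set.mem_Ioi.2 (by positivity)) ?_
  have hrn := pow_pos hr n
  have htn := pow_pos ht n
  rw [Real.log_mul (by positivity) (by positivity), Real.log_div (by positivity) (by positivity),
    Real.log_div (by positivity) (by positivity), Real.log_rpow (by positivity),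
    Real.log_rpow (by positivity), Real.log_rpow hk, Real.log_rpow ht,
    Real.log_mul (x := t / r ^ n) (by positivity) (by positivity),
    Real.log_div ht.ne' hrn.ne', Real.log_inv (_ * k), Real.log_mul (by positivity) hk.ne',
    Real.log_inv, Real.log_mul (by positivity) htn.ne', Real.log_inv, Real.log_pow, Real.log_pow]
  field_simp
  ring

theorem IsDualPair.asp_eq {n : ℕ} {K : Set (E n)} {ν ν' : E n → E n} {κ κ' : E n → ℝ}
    (h : IsDualPair K ν ν' κ) (hκ' : IsGaussCurvature (polarBody K) ν' κ')
    {p : ℝ} (hp : p ≠ -(n : ℝ)) (hp0 : p ≠ 0) :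
    asp p K ν κ = asp ((n : ℝ) ^ 2 / p) (polarBody K) ν' κ' := by
  have hX : MeasurableSet (frontier K) := isClosed_frontier.measurableSet
  have hY : MeasurableSet (frontier (polarBody K)) := isClosed_frontier.measurableSet
  have hJ : ∀ x ∈ frontier K, 0 < ⟪x, ν x⟫ / ‖x‖ ^ n * (polarDensity ν κ x)⁻¹ := fun x hx => by
    have := h.inner_pos hx
    have := h.norm_pos hx
    have := h.polarDensity_pos hx
    positivity
  set q := (n : ℝ) ^ 2 / p with hq
  set G : E n → ℝ := fun x => (⟪x, ν x⟫ / ‖x‖ ^ n * (polarDensity ν κ x)⁻¹) ^ (q / (n + q)) /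
    ‖x‖⁻¹ ^ (n * (q - 1) / (n + q)) with hG
  have hGc : ContinuousOn G (frontier K) := by
    have hi : ContinuousOn (fun x => ⟪x, ν x⟫) (frontier K) :=
      continuousOn_id.inner h.continuousOn_normal
    have hnorm : ContinuousOn (fun x : E n => ‖x‖) (frontier K) := continuous_norm.continuousOn
    have hr : ∀ x ∈ frontier K, ‖x‖ ≠ 0 := fun x hx => (h.norm_pos hx).ne'
    refine (((hi.div (hnorm.pow n) fun x hx => pow_ne_zero n (hr x hx)).mul
      (h.continuousOn_polarDensity.inv₀ fun x hx => (h.polarDensity_pos hx).ne')).rpow_const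
        fun x hx => Or.inl (hJ x hx).ne').div
      ((hnorm.inv₀ hr).rpow_const fun x hx => Or.inl (inv_ne_zero (hr x hx))) fun x hx => ?_
    have := h.norm_pos hx
    positivity
  have hDm : AEMeasurable (fun x => ENNReal.ofReal (polarDensity ν κ x))
      ((bdMeasure n).restrict (frontier K)) :=
    (h.continuousOn_polarDensity.aemeasurable hX).ennreal_ofReal
  have hGm : AEStronglyMeasurable G
      (((bdMeasure n).restrict (frontier (polarBody K))).map (polarInv K ν)) := by
    rw [h.map_polarInv]
    exact (hGc.aestronglyMeasurable hX).mono_ac (withDensity_absolutelyContinuous _ _)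
  have hpolar : asp q (polarBody K) ν' κ' =
      ∫ y in frontier (polarBody K), G (polarInv K ν y) ∂bdMeasure n := by
    refine integral_congr_ae ?_
    filter_upwards [hκ', ae_restrict_mem hY] with y hy hyY
    obtain ⟨x, hx, rfl⟩ := h.bijOn_polarMap.surjOn hyY
    rw [tendsto_nhds_unique hy (h.isGaussCurvatureAt_polar hx), h.inner_normal_polarMap hx,
      h.polarInv_polarMap hx]
  rw [hpolar, ← integral_map h.aemeasurable_polarInv hGm, h.map_polarInv,
    integral_withDensity_eq_integral_toReal_smul₀ hDm (by simp)]
  refine setIntegral_congr_fun hX fun x hx => ?_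
  have hn : n ≠ 0 := by
    rintro rfl
    have := h.norm_pos hx
    rw [Subsingleton.elim x 0, norm_zero] at this
    exact lt_irrefl _ this
  simp only [ENNReal.toReal_ofReal (h.polarDensity_pos hx).le, smul_eq_mul, hG]
  exact (mul_rpow_div_rpow_dual hn hp hp0 (h.norm_pos hx) (h.inner_pos hx)
    (h.curvature_pos x hx)).symm

/-- The duality formula `as_p(K) = as_{n²/p}(K°)`. -/
theorem statement6 (n : ℕ)
    (K : Set (E n)) (ν ν' : E n → E n) (κ κ' : E n → ℝ)
    (hK : IsC2PlusBody K ν κ) (hcen : CentroidAtOrigin K)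
    (hν' : IsOuterNormal (polarBody K) ν')
    (hκ' : IsGaussCurvature (polarBody K) ν' κ')
    (p : ℝ) (hp : p ≠ -(n : ℝ)) (hp0 : p ≠ 0) :
    asp p K ν κ = asp (((n : ℝ)) ^ 2 / p) (polarBody K) ν' κ' := by
  obtain ⟨hbody, hν, hc, hcκ, hbij, hκ⟩ := hK
  exact IsDualPair.asp_eq ⟨hbody, zero_mem_interior_of_centroid hbody hcen, hν, hc, hcκ, hbij,
    fun x hx => (hκ x hx).1, fun x hx => (hκ x hx).2, hν'⟩ hκ' hp hp0
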